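/- Let Γ be a symmetric congestion game with n ≥ 1 players, common strategy set P of size q = |P| ≥ 3, non-negative non-decreasing cost functions, and temperature T ≥ 0. Suppose Rosenthal's potential, viewed as a function of strategy load profiles on L = {α ∈ ℕ^P : Σ_p α_p = n}, is M-convex (this holds for extension parallel congestion games by a result of Fujishige et al.). Let Φ_max = max_{s ∈ Pⁿ} Φ(s), assume T·Φ_max ≥ 1 and 0 < ε < 1, let π be the Gibbs distribution at temperature T and Q the relaxed logit dynamics kernel. Then for every initial profile s ∈ Pⁿ and every integer t ≥ n³·(log n + log log q + log(2·T·Φ_max/ε²)), the distribution Q^t(s,·) of the chain after t steps satisfies d_TV(Q^t(s,·), π) ≤ ε. -/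

import Mathlib

open Finset

section

variable {n : ℕ} {E : Type*} [Fintype E] [DecidableEq E]

/-- A strategy profile of a symmetric congestion game with common strategy set
`P ⊆ 2^E`. -/
abbrev SymProfile (n : ℕ) {E : Type*} [DecidableEq E] (P : Finset (Finset E)) :=
  Fin n → {A : Finset E // A ∈ P}

variable {P : Finset (Finset E)}

/-- The load `ℓ_e(s)`: the number of players using resource `e` in profile `s`. -/
def sload (s : SymProfile n P) (e : E) : ℕ :=
  (Finset.univ.filter fun i => e ∈ (s i : Finset E)).card

/-- Rosenthal's potential `Φ(s) = Σ_{e ∈ E} Σ_{k=1}^{ℓ_e(s)} c_e(k)`. -/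
noncomputable def sPhi (c : E → ℕ → ℝ) (s : SymProfile n P) : ℝ :=
  ∑ e : E, ∑ k ∈ Finset.Icc 1 (sload s e), c e k

/-- The strategy load `z_p(s) = |{i : s_i = p}|`. -/
def zload (s : SymProfile n P) (p : {A : Finset E // A ∈ P}) : ℕ :=
  (Finset.univ.filter fun i => s i = p).card

/-- `loadMove α p r = α − e_p + e_r` on strategy load profiles. -/
def loadMove (α : {A : Finset E // A ∈ P} → ℕ) (p r : {A : Finset E // A ∈ P}) :
    {A : Finset E // A ∈ P} → ℕ :=
  fun l => α l + (if l = r then 1 else 0) - (if l = p then 1 else 0)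

/-- The normalizing constant `Z_i(s_{−i}) = Σ_{r ∈ P} e^{−T·Φ(r, s_{−i})}`. -/
noncomputable def sZi (c : E → ℕ → ℝ) (T : ℝ) (s : SymProfile n P) (i : Fin n) : ℝ :=
  ∑ r : {A : Finset E // A ∈ P}, Real.exp (-T * sPhi c (Function.update s i r))

/-- The relaxed logit dynamics kernel, as a matrix indexed by strategy profiles. -/
noncomputable def relaxedLogitMatrix (c : E → ℕ → ℝ) (T : ℝ) (n : ℕ)
    (P : Finset (Finset E)) : Matrix (SymProfile n P) (SymProfile n P) ℝ :=
  Matrix.of fun s t =>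
    (1 / (2 * (n : ℝ) ^ 2)) *
        ((Finset.univ.filter fun ij : Fin n × Fin n => s ∘ Equiv.swap ij.1 ij.2 = t).card : ℝ)
      + (1 / (2 * (n : ℝ))) *
        ∑ i ∈ Finset.univ.filter fun i : Fin n => ∀ j, j ≠ i → t j = s j,
          Real.exp (-T * sPhi c t) / sZi c T s i

/-- The partition function `Z = Σ_t e^{−T·Φ(t)}`. -/
noncomputable def sZ (c : E → ℕ → ℝ) (T : ℝ) (n : ℕ) (P : Finset (Finset E)) : ℝ :=
  ∑ t : SymProfile n P, Real.exp (-T * sPhi c t)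

/-- The Gibbs distribution `π(s) = e^{−T·Φ(s)}/Z`. -/
noncomputable def sGibbs (c : E → ℕ → ℝ) (T : ℝ) (s : SymProfile n P) : ℝ :=
  Real.exp (-T * sPhi c s) / sZ c T n P

namespace RL

/-- `x log x`. -/
noncomputable def phi (x : ℝ) : ℝ := x * Real.log x

/-- `a log (a / b)`. -/
noncomputable def th (a b : ℝ) : ℝ := a * (Real.log a - Real.log b)

theorem th_ge (a b c : ℝ) (ha : 0 ≤ a) (hb : 0 ≤ b) (hab : b = 0 → a = 0) (hc : 0 < c) :
    a * Real.log c + a - b * c ≤ th a b := by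
  unfold th
  rcases ha.eq_or_lt with h | h
  · subst h
    have := mul_nonneg hb hc.le
    simp; exact this
  · have hb' : 0 < b := lt_of_le_of_ne hb (fun h0 => h.ne' (hab h0.symm))
    have h1 := Real.log_le_sub_one_of_pos (show 0 < b * c / a by positivity)
    rw [Real.log_div (by positivity) (by positivity), Real.log_mul (by positivity) (by positivity)] at h1
    have h2 := mul_le_mul_of_nonneg_left h1 ha
    have h3 : a * (b * c / a - 1) = b * c - a := by field_simp
    nlinarith

theorem th_sum {ι : Type*} (I : Finset ι) (a b : ι → ℝ) (ha : ∀ i ∈ I, 0 ≤ a i)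
    (hb : ∀ i ∈ I, 0 ≤ b i) (hab : ∀ i ∈ I, b i = 0 → a i = 0) :
    th (∑ i ∈ I, a i) (∑ i ∈ I, b i) ≤ ∑ i ∈ I, th (a i) (b i) := by
  rcases (Finset.sum_nonneg ha).eq_or_lt with h | h
  · have h0 : ∀ i ∈ I, a i = 0 := (Finset.sum_eq_zero_iff_of_nonneg ha).1 h.symm
    rw [← h]
    have : ∑ i ∈ I, th (a i) (b i) = 0 := Finset.sum_eq_zero (fun i hi => by simp [th, h0 i hi])
    rw [this]; simp [th]
  · have hB : 0 < ∑ i ∈ I, b i := by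
      refine lt_of_le_of_ne (Finset.sum_nonneg hb) (fun h0 => ?_)
      have h1 := (Finset.sum_eq_zero_iff_of_nonneg hb).1 h0.symm
      have : ∑ i ∈ I, a i = 0 := Finset.sum_eq_zero (fun i hi => hab i hi (h1 i hi))
      linarith
    set A := ∑ i ∈ I, a i with hA
    set B := ∑ i ∈ I, b i with hBd
    have h1 : ∑ i ∈ I, (a i * Real.log (A / B) + a i - b i * (A / B)) ≤ ∑ i ∈ I, th (a i) (b i) :=
      Finset.sum_le_sum fun i hi => th_ge _ _ _ (ha i hi) (hb i hi) (hab i hi) (by positivity)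
    rw [Finset.sum_sub_distrib, Finset.sum_add_distrib, ← Finset.sum_mul, ← Finset.sum_mul, ← hA, ← hBd,
      Real.log_div h.ne' hB.ne'] at h1
    have h2 : B * (A / B) = A := by field_simp
    unfold th at *
    linarith

theorem th_div (a b c : ℝ) (hab : b = 0 → a = 0) (hc : 0 < c) :
    th (a / c) (b / c) = th a b / c := by
  unfold th
  by_cases h : a = 0
  · simp [h]
  · have hb : b ≠ 0 := fun h0 => h (hab h0)
    rw [Real.log_div h hc.ne', Real.log_div hb hc.ne']; ring

theorem th_avg {ι : Type*} (I : Finset ι) (hI : I.Nonempty) (a b : ι → ℝ) (ha : ∀ i ∈ I, 0 ≤ a i)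
    (hb : ∀ i ∈ I, 0 ≤ b i) (hab : ∀ i ∈ I, b i = 0 → a i = 0) :
    th ((∑ i ∈ I, a i) / (I.card : ℝ)) ((∑ i ∈ I, b i) / (I.card : ℝ)) ≤
      (∑ i ∈ I, th (a i) (b i)) / (I.card : ℝ) := by
  have hc : (0 : ℝ) < I.card := by exact_mod_cast hI.card_pos
  rw [th_div _ _ _ _ hc]
  · exact div_le_div_of_nonneg_right (th_sum I a b ha hb hab) hc.le
  · intro h0
    have h1 := (Finset.sum_eq_zero_iff_of_nonneg hb).1 h0
    exact Finset.sum_eq_zero (fun i hi => hab i hi (h1 i hi))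

/-- two point Jensen gap of `phi` -/
noncomputable def gap2 (a b : ℝ) : ℝ := phi a / 2 + phi b / 2 - phi ((a + b) / 2)

theorem gap2_eq (a b : ℝ) : gap2 a b = th a ((a + b) / 2) / 2 + th b ((a + b) / 2) / 2 := by
  unfold gap2 phi th; ring

theorem gap2_avg {ι : Type*} (I : Finset ι) (hI : I.Nonempty) (a b : ι → ℝ) (ha : ∀ i ∈ I, 0 ≤ a i)
    (hb : ∀ i ∈ I, 0 ≤ b i) :
    gap2 ((∑ i ∈ I, a i) / (I.card : ℝ)) ((∑ i ∈ I, b i) / (I.card : ℝ)) ≤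
      (∑ i ∈ I, gap2 (a i) (b i)) / (I.card : ℝ) := by
  have e : ((∑ i ∈ I, a i) / (I.card : ℝ) + (∑ i ∈ I, b i) / (I.card : ℝ)) / 2
      = (∑ i ∈ I, (a i + b i) / 2) / (I.card : ℝ) := by
    rw [← Finset.sum_div, Finset.sum_add_distrib]; ring
  rw [gap2_eq, e]
  have h1 := th_avg I hI a (fun i => (a i + b i) / 2) ha
    (fun i hi => by have := ha i hi; have := hb i hi; positivity)
    (fun i hi h => by have := ha i hi; have := hb i hi; linarith)
  have h2 := th_avg I hI b (fun i => (a i + b i) / 2) hb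
    (fun i hi => by have := ha i hi; have := hb i hi; positivity)
    (fun i hi h => by have := ha i hi; have := hb i hi; linarith)
  have h3 : (∑ i ∈ I, gap2 (a i) (b i)) / (I.card : ℝ) =
      (∑ i ∈ I, th (a i) ((a i + b i) / 2)) / (I.card : ℝ) / 2
      + (∑ i ∈ I, th (b i) ((a i + b i) / 2)) / (I.card : ℝ) / 2 := by
    simp only [gap2_eq, Finset.sum_add_distrib, ← Finset.sum_div]; ring
  rw [h3]; linarith

theorem phi_convex2 (a b l m : ℝ) (ha : 0 ≤ a) (hb : 0 ≤ b) (hl : 0 ≤ l) (hm : 0 ≤ m)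
    (hlm : l + m = 1) : phi (l * a + m * b) ≤ l * phi a + m * phi b := by
  have := Real.convexOn_mul_log.2 (x := a) (y := b) ha hb hl hm hlm
  simpa [phi, smul_eq_mul] using this

theorem phi_ge (x : ℝ) (hx : 0 ≤ x) : x - 1 + (Real.sqrt x - 1) ^ 2 ≤ phi x := by
  unfold phi
  rcases hx.eq_or_lt with h | h
  · subst h; simp
  · obtain ⟨y, hy, rfl⟩ : ∃ y : ℝ, 0 < y ∧ x = y ^ 2 := ⟨Real.sqrt x, Real.sqrt_pos.2 h, (Real.sq_sqrt hx).symm⟩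
    rw [Real.sqrt_sq hy.le, Real.log_pow]
    have h1 := Real.one_sub_inv_le_log_of_pos hy
    have h2 : y ^ 2 * (1 - y⁻¹) ≤ y ^ 2 * Real.log y := mul_le_mul_of_nonneg_left h1 (by positivity)
    have h3 : y ^ 2 * (1 - y⁻¹) = y ^ 2 - y := by field_simp
    push_cast
    nlinarith

section F
variable {Ω : Type*} [Fintype Ω] (w : Ω → ℝ)

/-- entropy functional -/
noncomputable def F (h : Ω → ℝ) : ℝ := ∑ s, w s * phi (h s)

variable {w}

theorem F_convex2 (hw : ∀ s, 0 ≤ w s) (a b : Ω → ℝ) (l m : ℝ) (ha : ∀ s, 0 ≤ a s)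
    (hb : ∀ s, 0 ≤ b s) (hl : 0 ≤ l) (hm : 0 ≤ m) (hlm : l + m = 1) :
    F w (fun s => l * a s + m * b s) ≤ l * F w a + m * F w b := by
  unfold F
  rw [Finset.mul_sum, Finset.mul_sum, ← Finset.sum_add_distrib]
  refine Finset.sum_le_sum fun s _ => ?_
  have := mul_le_mul_of_nonneg_left (phi_convex2 (a s) (b s) l m (ha s) (hb s) hl hm hlm) (hw s)
  linarith

theorem F_convex {ι : Type*} (hw : ∀ s, 0 ≤ w s) (I : Finset ι) (l : ι → ℝ) (a : ι → Ω → ℝ)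
    (ha : ∀ i ∈ I, ∀ s, 0 ≤ a i s) (hl : ∀ i ∈ I, 0 ≤ l i) (hl1 : ∑ i ∈ I, l i = 1) :
    F w (fun s => ∑ i ∈ I, l i * a i s) ≤ ∑ i ∈ I, l i * F w (a i) := by
  unfold F
  simp only [Finset.mul_sum]
  rw [Finset.sum_comm]
  refine Finset.sum_le_sum fun s _ => ?_
  have h := Real.convexOn_mul_log.map_sum_le (t := I) (w := l) (p := fun i => a i s) hl hl1
    (fun i hi => ha i hi s)
  simp only [smul_eq_mul] at h
  have := mul_le_mul_of_nonneg_left h (hw s)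
  rw [Finset.mul_sum] at this
  refine this.trans (le_of_eq (Finset.sum_congr rfl fun i _ => ?_))
  simp only [phi]; ring

theorem F_nonneg (hw : ∀ s, 0 ≤ w s) (hw1 : ∑ s, w s = 1) (h : Ω → ℝ) (hh : ∀ s, 0 ≤ h s)
    (h1 : ∑ s, w s * h s = 1) : 0 ≤ F w h := by
  unfold F
  have : ∑ s, w s * (h s - 1) ≤ ∑ s, w s * phi (h s) := by
    refine Finset.sum_le_sum fun s _ => mul_le_mul_of_nonneg_left ?_ (hw s)
    have := phi_ge (h s) (hh s)
    nlinarith [sq_nonneg (Real.sqrt (h s) - 1)]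
  have e : ∑ s, w s * (h s - 1) = 0 := by
    simp only [mul_sub, Finset.sum_sub_distrib, mul_one]; linarith
  linarith

theorem pinsker (hw : ∀ s, 0 ≤ w s) (hw1 : ∑ s, w s = 1) (h : Ω → ℝ) (hh : ∀ s, 0 ≤ h s)
    (h1 : ∑ s, w s * h s = 1) : (∑ s, w s * |h s - 1|) ^ 2 ≤ 4 * F w h := by
  have a1 : ∑ s, w s * (Real.sqrt (h s) - 1) ^ 2 ≤ F w h := by
    have : ∑ s, w s * (h s - 1 + (Real.sqrt (h s) - 1) ^ 2) ≤ F w h :=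
      Finset.sum_le_sum fun s _ => mul_le_mul_of_nonneg_left (phi_ge (h s) (hh s)) (hw s)
    have e : ∑ s, w s * (h s - 1) = 0 := by
      simp only [mul_sub, Finset.sum_sub_distrib, mul_one]; linarith
    simp only [mul_add, Finset.sum_add_distrib] at this
    linarith
  have a2 : ∑ s, w s * (Real.sqrt (h s) + 1) ^ 2 ≤ 4 := by
    have : ∑ s, w s * (Real.sqrt (h s) + 1) ^ 2 ≤ ∑ s, (2 * (w s * h s) + 2 * w s) := by
      refine Finset.sum_le_sum fun s _ => ?_
      have e := Real.sq_sqrt (hh s)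
      have : (Real.sqrt (h s) + 1) ^ 2 ≤ 2 * h s + 2 := by nlinarith [sq_nonneg (Real.sqrt (h s) - 1)]
      nlinarith [mul_le_mul_of_nonneg_left this (hw s)]
    rw [Finset.sum_add_distrib, ← Finset.mul_sum, ← Finset.mul_sum, h1, hw1] at this
    linarith
  have a3 : (∑ s, w s * |h s - 1|) ^ 2 ≤
      (∑ s, w s * (Real.sqrt (h s) - 1) ^ 2) * ∑ s, w s * (Real.sqrt (h s) + 1) ^ 2 := by
    refine Finset.sum_sq_le_sum_mul_sum_of_sq_le_mul _ (fun s _ => ?_) (fun s _ => ?_) (fun s _ => le_of_eq ?_)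
    · exact mul_nonneg (hw s) (sq_nonneg _)
    · exact mul_nonneg (hw s) (sq_nonneg _)
    · have e := Real.sq_sqrt (hh s)
      have : h s - 1 = (Real.sqrt (h s) - 1) * (Real.sqrt (h s) + 1) := by nlinarith
      rw [mul_pow, sq_abs, this]; ring
  have a4 : 0 ≤ ∑ s, w s * (Real.sqrt (h s) - 1) ^ 2 :=
    Finset.sum_nonneg fun s _ => mul_nonneg (hw s) (sq_nonneg _)
  nlinarith

/-- Averages of functions with equal entropy and controlled pair gaps. -/
theorem F_avg_ge {ι : Type*} (hw : ∀ s, 0 ≤ w s) (I : Finset ι) (g : ι → Ω → ℝ)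
    (hg : ∀ i, ∀ s, 0 ≤ g i s) (c γ : ℝ) (hF : ∀ i ∈ I, F w (g i) = c)
    (hgap : ∀ i ∈ I, ∀ j ∈ I, i ≠ j → ∑ s, w s * gap2 (g i s) (g j s) ≤ γ) (hI : I.Nonempty) :
    c - ((I.card : ℝ) - 1) * γ ≤ F w (fun s => (∑ i ∈ I, g i s) / (I.card : ℝ)) := by
  classical
  induction hI using Finset.Nonempty.cons_induction with
  | singleton a => simp [hF a]
  | cons a I ha hI ih =>
    have hc : (0 : ℝ) < I.card := by exact_mod_cast hI.card_pos
    have hc1 : (1 : ℝ) ≤ I.card := by exact_mod_cast hI.card_pos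
    have ih' := ih (fun i hi => hF i (Finset.mem_cons_of_mem hi))
      (fun i hi j hj => hgap i (Finset.mem_cons_of_mem hi) j (Finset.mem_cons_of_mem hj))
    set A : Ω → ℝ := fun s => (∑ i ∈ I, g i s) / (I.card : ℝ) with hA
    have hA0 : ∀ s, 0 ≤ A s := fun s => div_nonneg (Finset.sum_nonneg fun i _ => hg i s) hc.le
    have hFa := hF a (Finset.mem_cons_self a I)
    -- gap between A and g a
    have k1 : ∑ s, w s * gap2 (A s) (g a s) ≤ γ := by
      have : ∑ s, w s * gap2 (A s) (g a s) ≤ ∑ s, w s * ((∑ i ∈ I, gap2 (g i s) (g a s)) / (I.card : ℝ)) := by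
        refine Finset.sum_le_sum fun s _ => mul_le_mul_of_nonneg_left ?_ (hw s)
        have := gap2_avg I hI (fun i => g i s) (fun i => g a s) (fun i _ => hg i s) (fun i _ => hg a s)
        have e : (∑ i ∈ I, g a s) / (I.card : ℝ) = g a s := by
          rw [Finset.sum_const, nsmul_eq_mul]; field_simp
        rw [e] at this; exact this
      refine this.trans ?_
      have e : ∑ s, w s * ((∑ i ∈ I, gap2 (g i s) (g a s)) / (I.card : ℝ))
          = (∑ i ∈ I, ∑ s, w s * gap2 (g i s) (g a s)) / (I.card : ℝ) := by
        rw [Finset.sum_comm, Finset.sum_div]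
        refine Finset.sum_congr rfl fun s _ => ?_
        rw [← Finset.mul_sum]; ring
      rw [e, div_le_iff₀ hc]
      have : ∑ i ∈ I, ∑ s, w s * gap2 (g i s) (g a s) ≤ ∑ i ∈ I, γ :=
        Finset.sum_le_sum fun i hi => hgap i (Finset.mem_cons_of_mem hi) a (Finset.mem_cons_self a I)
          (fun h => ha (h ▸ hi))
      rw [Finset.sum_const, nsmul_eq_mul] at this
      linarith
    have k2 : ∑ s, w s * gap2 (A s) (g a s) =
        F w A / 2 + F w (g a) / 2 - F w (fun s => (A s + g a s) / 2) := by
      unfold F gap2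
      rw [Finset.sum_div, Finset.sum_div, ← Finset.sum_add_distrib, ← Finset.sum_sub_distrib]
      exact Finset.sum_congr rfl fun s _ => by ring
    set m : ℝ := (I.card : ℝ) with hm
    set B : Ω → ℝ := fun s => (∑ i ∈ Finset.cons a I ha, g i s) / ((Finset.cons a I ha).card : ℝ) with hB
    have hcard : ((Finset.cons a I ha).card : ℝ) = m + 1 := by
      rw [Finset.card_cons]; push_cast; rfl
    have hBe : ∀ s, B s = (m * A s + g a s) / (m + 1) := by
      intro s
      simp only [hB, hA, hcard, Finset.sum_cons]
      field_simp; ring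
    have hB0 : ∀ s, 0 ≤ B s := fun s => by
      rw [hBe]; have := hA0 s; have := hg a s; positivity
    have k3 := F_convex2 hw B (g a) ((m + 1) / (2 * m)) ((m - 1) / (2 * m)) hB0 (hg a) (by positivity)
      (div_nonneg (by linarith) (by positivity)) (by field_simp; ring)
    have k4 : (fun s => (m + 1) / (2 * m) * B s + (m - 1) / (2 * m) * g a s) =
        fun s => (A s + g a s) / 2 := by
      funext s; rw [hBe]; field_simp; ring
    rw [k4, hFa] at k3
    rw [k2, hFa] at k1
    rw [hcard]
    have k5 : (m + 1) / (2 * m) * F w B + (m - 1) / (2 * m) * c = ((m + 1) * F w B + (m - 1) * c) / (2 * m) := by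
      ring
    rw [k5, le_div_iff₀ (by positivity)] at k3
    have k6 := mul_le_mul_of_nonneg_left k1 (show (0:ℝ) ≤ 2 * m by positivity)
    have k7 := mul_le_mul_of_nonneg_left ih' hc.le
    have : (m + 1) * (c - (m + 1 - 1) * γ) ≤ (m + 1) * F w B := by nlinarith
    exact le_of_mul_le_mul_left this (by positivity)

end F
end RL

namespace RL
section B
set_option linter.unusedSectionVars false
set_option linter.unusedVariables false
variable {N : ℕ} {X : Type*} [Fintype X] (w : (Fin N → X) → ℝ)

theorem sum_comp_perm (σ : Equiv.Perm (Fin N)) (f : (Fin N → X) → ℝ) :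
    ∑ s, f (s ∘ σ) = ∑ s, f s :=
  Fintype.sum_equiv (Equiv.arrowCongr σ.symm (Equiv.refl X)) _ _ (fun s => by
    congr 1)

/-- entropy gain of averaging with a permutation -/
noncomputable def pg (σ : Equiv.Perm (Fin N)) (h : (Fin N → X) → ℝ) : ℝ :=
  ∑ s, w s * gap2 (h s) (h (s ∘ σ))

/-- heat bath update of coordinate `i` -/
noncomputable def Gi (i : Fin N) (h : (Fin N → X) → ℝ) (s : Fin N → X) : ℝ :=
  (∑ r, w (Function.update s i r) * h (Function.update s i r)) / ∑ r, w (Function.update s i r)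

/-- entropy gain of the heat bath update -/
noncomputable def Gam (i : Fin N) (h : (Fin N → X) → ℝ) : ℝ :=
  ∑ s, w s * th (h s) (Gi w i h s)

variable {w}

theorem F_perm (hws : ∀ (σ : Equiv.Perm (Fin N)) s, w (s ∘ σ) = w s) (σ : Equiv.Perm (Fin N))
    (h : (Fin N → X) → ℝ) : F w (fun s => h (s ∘ σ)) = F w h := by
  unfold F
  rw [← sum_comp_perm σ (fun s => w s * phi (h s))]
  simp only [hws]

theorem pg_eq (hws : ∀ (σ : Equiv.Perm (Fin N)) s, w (s ∘ σ) = w s) (σ : Equiv.Perm (Fin N))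
    (h : (Fin N → X) → ℝ) : pg w σ h = F w h - F w (fun s => (h s + h (s ∘ σ)) / 2) := by
  have e := F_perm hws σ h
  have : pg w σ h = F w h / 2 + F w (fun s => h (s ∘ σ)) / 2 - F w (fun s => (h s + h (s ∘ σ)) / 2) := by
    unfold pg F gap2
    rw [Finset.sum_div, Finset.sum_div, ← Finset.sum_add_distrib, ← Finset.sum_sub_distrib]
    exact Finset.sum_congr rfl fun s _ => by ring
  rw [this, e]; ring

theorem pg_conj (hws : ∀ (σ : Equiv.Perm (Fin N)) s, w (s ∘ σ) = w s) (σ τ : Equiv.Perm (Fin N))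
    (h : (Fin N → X) → ℝ) : pg w σ (fun s => h (s ∘ τ)) = pg w (τ⁻¹ * σ * τ) h := by
  unfold pg
  rw [← sum_comp_perm τ (fun s => w s * gap2 (h s) (h (s ∘ (τ⁻¹ * σ * τ : Equiv.Perm (Fin N)))))]
  refine Finset.sum_congr rfl fun s _ => ?_
  rw [hws]
  have e : (s ∘ τ) ∘ (τ⁻¹ * σ * τ : Equiv.Perm (Fin N)) = (s ∘ σ) ∘ τ := by
    funext i; simp
  rw [e]

theorem pg_avg (hw : ∀ s, 0 ≤ w s) {ι : Type*} (I : Finset ι) (hI : I.Nonempty) (σ : Equiv.Perm (Fin N))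
    (g : ι → (Fin N → X) → ℝ) (hg : ∀ i s, 0 ≤ g i s) :
    pg w σ (fun s => (∑ i ∈ I, g i s) / (I.card : ℝ)) ≤ (∑ i ∈ I, pg w σ (g i)) / (I.card : ℝ) := by
  unfold pg
  rw [Finset.sum_comm, Finset.sum_div]
  refine Finset.sum_le_sum fun s _ => ?_
  rw [← Finset.mul_sum, mul_div_assoc]
  exact mul_le_mul_of_nonneg_left (gap2_avg I hI (fun i => g i s) (fun i => g i (s ∘ σ))
    (fun i _ => hg i _) (fun i _ => hg i _)) (hw s)

theorem sum_update_swap (i : Fin N) (f : (Fin N → X) → X → ℝ) :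
    ∑ s, ∑ r, f s r = ∑ s, ∑ r, f (Function.update s i r) (s i) := by
  rw [← Fintype.sum_prod_type', ← Fintype.sum_prod_type' (f := fun s r => f (Function.update s i r) (s i))]
  let e : Function.Involutive (fun p : (Fin N → X) × X => (Function.update p.1 i p.2, p.1 i)) := by
    intro p; simp
  exact Fintype.sum_equiv e.toPerm _ _ (fun p => by simp [Function.Involutive.toPerm])

theorem Gi_update (i : Fin N) (h : (Fin N → X) → ℝ) (s : Fin N → X) (r : X) :
    Gi w i h (Function.update s i r) = Gi w i h s := by
  unfold Gi; simp

theorem sum_Gi_mul (hw : ∀ s, 0 < w s) (i : Fin N) (h k : (Fin N → X) → ℝ)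
    (hk : ∀ s r, k (Function.update s i r) = k s) :
    ∑ s, w s * (Gi w i h s * k s) = ∑ s, w s * (h s * k s) := by
  have hD : ∀ s : Fin N → X, 0 < ∑ r, w (Function.update s i r) := fun s =>
    Finset.sum_pos (fun r _ => hw _) ⟨s i, Finset.mem_univ _⟩
  have h1 : ∑ s, w s * (Gi w i h s * k s) = ∑ s, ∑ r, w s * (w (Function.update s i r) *
      h (Function.update s i r) / (∑ r, w (Function.update s i r)) * k s) := by
    refine Finset.sum_congr rfl fun s _ => ?_
    unfold Gi
    rw [Finset.sum_div, Finset.sum_mul, Finset.mul_sum]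
  rw [h1, sum_update_swap i]
  refine Finset.sum_congr rfl fun s _ => ?_
  simp only [Function.update_idem, Function.update_eq_self, hk]
  rw [← Finset.sum_mul]
  have := (hD s).ne'
  field_simp

theorem Gam_eq (hw : ∀ s, 0 < w s) (i : Fin N) (h : (Fin N → X) → ℝ) :
    Gam w i h = F w h - F w (Gi w i h) := by
  have := sum_Gi_mul hw i h (fun s => Real.log (Gi w i h s)) (fun s r => by rw [Gi_update])
  unfold Gam F phi th
  rw [this, ← Finset.sum_sub_distrib]
  exact Finset.sum_congr rfl fun s _ => by ring

theorem Gi_perm (hws : ∀ (σ : Equiv.Perm (Fin N)) s, w (s ∘ σ) = w s) (τ : Equiv.Perm (Fin N))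
    (i : Fin N) (h : (Fin N → X) → ℝ) (s : Fin N → X) :
    Gi w i (fun s => h (s ∘ τ)) s = Gi w (τ.symm i) h (s ∘ τ) := by
  have e : ∀ r, Function.update (s ∘ τ) (τ.symm i) r = Function.update s i r ∘ τ := by
    intro r; funext j
    simp only [Function.update_apply, Function.comp, Equiv.eq_symm_apply]
  unfold Gi
  simp only [e, hws]

theorem Gam_perm (hws : ∀ (σ : Equiv.Perm (Fin N)) s, w (s ∘ σ) = w s) (τ : Equiv.Perm (Fin N))
    (i : Fin N) (h : (Fin N → X) → ℝ) :
    Gam w i (fun s => h (s ∘ τ)) = Gam w (τ.symm i) h := by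
  unfold Gam
  rw [← sum_comp_perm τ (fun s => w s * th (h s) (Gi w (τ.symm i) h s))]
  exact Finset.sum_congr rfl fun s _ => by rw [Gi_perm hws, hws]

theorem Gi_nonneg (hw : ∀ s, 0 < w s) (i : Fin N) (h : (Fin N → X) → ℝ) (hh : ∀ s, 0 ≤ h s)
    (s : Fin N → X) : 0 ≤ Gi w i h s :=
  div_nonneg (Finset.sum_nonneg fun r _ => mul_nonneg (hw _).le (hh _))
    (Finset.sum_nonneg fun r _ => (hw _).le)

theorem Gi_zero (hw : ∀ s, 0 < w s) (i : Fin N) (h : (Fin N → X) → ℝ) (hh : ∀ s, 0 ≤ h s)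
    (s : Fin N → X) (h0 : Gi w i h s = 0) : h s = 0 := by
  have hD : 0 < ∑ r, w (Function.update s i r) :=
    Finset.sum_pos (fun r _ => hw _) ⟨s i, Finset.mem_univ _⟩
  unfold Gi at h0
  rw [div_eq_zero_iff, or_iff_left hD.ne'] at h0
  have := (Finset.sum_eq_zero_iff_of_nonneg (fun r _ => mul_nonneg (hw _).le (hh _))).1 h0 (s i) (Finset.mem_univ _)
  rw [Function.update_eq_self] at this
  exact (mul_eq_zero.1 this).resolve_left (hw s).ne'

theorem Gam_avg (hw : ∀ s, 0 < w s) {ι : Type*} (I : Finset ι) (hI : I.Nonempty) (k : Fin N)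
    (g : ι → (Fin N → X) → ℝ) (hg : ∀ i s, 0 ≤ g i s) :
    Gam w k (fun s => (∑ i ∈ I, g i s) / (I.card : ℝ)) ≤ (∑ i ∈ I, Gam w k (g i)) / (I.card : ℝ) := by
  unfold Gam
  rw [Finset.sum_comm, Finset.sum_div]
  refine Finset.sum_le_sum fun s _ => ?_
  rw [← Finset.mul_sum, mul_div_assoc]
  refine mul_le_mul_of_nonneg_left ?_ (hw s).le
  have e : Gi w k (fun s => (∑ i ∈ I, g i s) / (I.card : ℝ)) s = (∑ i ∈ I, Gi w k (g i) s) / (I.card : ℝ) := by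
    unfold Gi
    rw [← Finset.sum_div, div_right_comm]
    congr 1
    rw [Finset.sum_comm, Finset.sum_div]
    refine Finset.sum_congr rfl fun r _ => ?_
    rw [← Finset.mul_sum]; ring
  rw [e]
  exact th_avg I hI (fun i => g i s) (fun i => Gi w k (g i) s) (fun i _ => hg i s)
    (fun i _ => Gi_nonneg hw k _ (hg i) s) (fun i _ => Gi_zero hw k _ (hg i) s)

/-- One symmetrization step. -/
noncomputable def R (κ : Fin N) (g : (Fin N → X) → ℝ) (s : Fin N → X) : ℝ :=
  (∑ j ∈ Finset.Iic κ, g (s ∘ Equiv.swap j κ)) / ((Finset.Iic κ).card : ℝ)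

/-- invariance under permutations of the first `k` coordinates -/
def Inv (k : ℕ) (g : (Fin N → X) → ℝ) : Prop :=
  ∀ σ : Equiv.Perm (Fin N), (∀ i, k ≤ i.val → σ i = i) → ∀ s, g (s ∘ σ) = g s

theorem R_nonneg (κ : Fin N) (g : (Fin N → X) → ℝ) (hg : ∀ s, 0 ≤ g s) (s : Fin N → X) :
    0 ≤ R κ g s := div_nonneg (Finset.sum_nonneg fun _ _ => hg _) (Nat.cast_nonneg _)

theorem Iic_ne (κ : Fin N) : (Finset.Iic κ).Nonempty := ⟨κ, by simp⟩

theorem R_inv (κ : Fin N) (g : (Fin N → X) → ℝ) (hg : Inv κ.val g) : Inv (κ.val + 1) (R κ g) := by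
  intro σ hσ s
  unfold R
  congr 1
  have hpres : ∀ j, j ≤ κ → σ j ≤ κ := by
    intro j hj
    by_contra hlt
    rw [not_le] at hlt
    have h1 := hσ (σ j) hlt
    have h2 := σ.injective h1
    rw [h2] at hlt
    exact absurd hj (not_le.2 hlt)
  have hpres' : ∀ j, j ≤ κ → σ.symm j ≤ κ := by
    intro j hj
    by_contra hlt
    rw [not_le] at hlt
    have h1 := hσ (σ.symm j) hlt
    rw [Equiv.apply_symm_apply] at h1
    rw [← h1] at hlt
    exact absurd hj (not_le.2 hlt)
  refine Finset.sum_bij' (fun j _ => σ j) (fun j _ => σ.symm j) ?_ ?_ ?_ ?_ ?_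
  · intro j hj; rw [Finset.mem_Iic] at *; exact hpres j hj
  · intro j hj; rw [Finset.mem_Iic] at *; exact hpres' j hj
  · intro j hj; simp
  · intro j hj; simp
  · intro j hj
    rw [Finset.mem_Iic] at hj
    have e : (s ∘ σ) ∘ Equiv.swap j κ = (s ∘ Equiv.swap (σ j) κ) ∘
        (Equiv.swap (σ j) κ * σ * Equiv.swap j κ : Equiv.Perm (Fin N)) := by
      funext i; simp
    rw [e]
    apply hg
    intro i hi
    rcases hi.eq_or_lt with h | h
    · have : i = κ := Fin.ext h.symm
      subst this; simp
    · have h1 : κ < i := h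
      have h2 : Equiv.swap j κ i = i := Equiv.swap_apply_of_ne_of_ne (lt_of_le_of_lt hj h1).ne' h1.ne'
      have h3 : Equiv.swap (σ j) κ i = i := Equiv.swap_apply_of_ne_of_ne (lt_of_le_of_lt (hpres j hj) h1).ne' h1.ne'
      simp [h2, hσ i h, h3]

theorem sum_R (hws : ∀ (σ : Equiv.Perm (Fin N)) s, w (s ∘ σ) = w s) (κ : Fin N)
    (g : (Fin N → X) → ℝ) : ∑ s, w s * R κ g s = ∑ s, w s * g s := by
  have hc : (0 : ℝ) < (Finset.Iic κ).card := by exact_mod_cast (Iic_ne κ).card_pos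
  have : ∑ s, w s * R κ g s = (∑ j ∈ Finset.Iic κ, ∑ s, w s * g (s ∘ Equiv.swap j κ)) / ((Finset.Iic κ).card : ℝ) := by
    unfold R
    rw [Finset.sum_comm, Finset.sum_div]
    refine Finset.sum_congr rfl fun s _ => ?_
    rw [← Finset.mul_sum]; ring
  rw [this]
  have e : ∀ j ∈ Finset.Iic κ, ∑ s, w s * g (s ∘ Equiv.swap j κ) = ∑ s, w s * g s := by
    intro j _
    rw [← sum_comp_perm (Equiv.swap j κ) (fun s => w s * g s)]
    simp only [hws]
  rw [Finset.sum_congr rfl e, Finset.sum_const, nsmul_eq_mul]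
  field_simp

/-- for `g` invariant under the first `κ` coordinates, pair gaps coincide -/
theorem inv_swap (κ : Fin N) (g : (Fin N → X) → ℝ) (hg : Inv κ.val g) (τ : Equiv.Perm (Fin N)) (i : Fin N)
    (hi : i ≤ κ) (h1 : τ κ = i) (h2 : ∀ j, κ < j → τ j = j) (s : Fin N → X) :
    g (s ∘ τ) = g (s ∘ Equiv.swap i κ) := by
  have e : s ∘ τ = (s ∘ Equiv.swap i κ) ∘ (Equiv.swap i κ * τ : Equiv.Perm (Fin N)) := by
    funext j; simp
  rw [e]
  apply hg
  intro j hj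
  rcases hj.eq_or_lt with h | h
  · have : j = κ := Fin.ext h.symm
    subst this; simp [h1]
  · have h3 : κ < j := h
    simp [h2 j h3, Equiv.swap_apply_of_ne_of_ne (lt_of_le_of_lt hi h3).ne' h3.ne']

theorem pg_inv_eq (hws : ∀ (σ : Equiv.Perm (Fin N)) s, w (s ∘ σ) = w s) (κ : Fin N)
    (g : (Fin N → X) → ℝ) (hg : Inv κ.val g) (i j : Fin N) (hi : i < κ) (hj : j < κ) :
    pg w (Equiv.swap i κ) g = pg w (Equiv.swap j κ) g := by
  by_cases hij : i = j
  · rw [hij]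
  unfold pg
  rw [← sum_comp_perm (Equiv.swap i j) (fun s => w s * gap2 (g s) (g (s ∘ Equiv.swap i κ)))]
  refine Finset.sum_congr rfl fun s _ => ?_
  rw [hws]
  have e1 : g (s ∘ Equiv.swap i j) = g s := by
    apply hg
    intro l hl
    have hl' : κ ≤ l := hl
    exact Equiv.swap_apply_of_ne_of_ne (lt_of_lt_of_le hi hl').ne' (lt_of_lt_of_le hj hl').ne'
  have e2 : g ((s ∘ Equiv.swap i j) ∘ Equiv.swap i κ) = g (s ∘ Equiv.swap j κ) := by
    refine inv_swap κ g hg (Equiv.swap i j * Equiv.swap i κ) j hj.le (by simp) ?_ s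
    intro l hl
    simp [Equiv.swap_apply_of_ne_of_ne (hi.trans hl).ne' hl.ne',
      Equiv.swap_apply_of_ne_of_ne (hi.trans hl).ne' (hj.trans hl).ne']
  rw [e1, e2]

theorem gap_inv_eq (hws : ∀ (σ : Equiv.Perm (Fin N)) s, w (s ∘ σ) = w s) (κ : Fin N)
    (g : (Fin N → X) → ℝ) (hg : Inv κ.val g) (i j : Fin N) (hi : i < κ) (hj : j ≤ κ) (hij : i ≠ j) :
    ∑ s, w s * gap2 (g (s ∘ Equiv.swap j κ)) (g (s ∘ Equiv.swap i κ)) = pg w (Equiv.swap i κ) g := by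
  unfold pg
  rw [← sum_comp_perm (Equiv.swap j κ)]
  refine Finset.sum_congr rfl fun s _ => ?_
  rw [hws]
  have e1 : (s ∘ Equiv.swap j κ) ∘ Equiv.swap j κ = s := by funext l; simp
  have e2 : g ((s ∘ Equiv.swap j κ) ∘ Equiv.swap i κ) = g (s ∘ Equiv.swap i κ) := by
    refine inv_swap κ g hg (Equiv.swap j κ * Equiv.swap i κ) i hi.le ?_ ?_ s
    · simp [Equiv.swap_apply_of_ne_of_ne hij hi.ne]
    · intro l hl
      simp [Equiv.swap_apply_of_ne_of_ne (hi.trans hl).ne' hl.ne',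
        Equiv.swap_apply_of_ne_of_ne (lt_of_le_of_lt hj hl).ne' hl.ne']
  rw [e1, e2]

theorem gap2_comm (a b : ℝ) : gap2 a b = gap2 b a := by
  unfold gap2; rw [add_comm a b]; ring

theorem R_step (hw : ∀ s, 0 < w s) (hws : ∀ (σ : Equiv.Perm (Fin N)) s, w (s ∘ σ) = w s) (κ : Fin N)
    (g : (Fin N → X) → ℝ) (hg0 : ∀ s, 0 ≤ g s) (hg : Inv κ.val g) :
    F w g - F w (R κ g) ≤ ∑ i ∈ Finset.Iio κ, pg w (Equiv.swap i κ) g := by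
  set γ : ℝ := (∑ i ∈ Finset.Iio κ, pg w (Equiv.swap i κ) g) / (κ.val : ℝ) with hγ
  have hγi : ∀ i, i < κ → pg w (Equiv.swap i κ) g = γ := by
    intro i hi
    have : ∑ j ∈ Finset.Iio κ, pg w (Equiv.swap j κ) g = ∑ j ∈ Finset.Iio κ, pg w (Equiv.swap i κ) g :=
      Finset.sum_congr rfl fun j hj => pg_inv_eq hws κ g hg j i (Finset.mem_Iio.1 hj) hi
    rw [hγ, this, Finset.sum_const, nsmul_eq_mul, Fin.card_Iio]
    have : (0 : ℝ) < κ.val := by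
      have : i.val < κ.val := hi
      exact_mod_cast (Nat.zero_le _).trans_lt this
    field_simp
  have hsum : ∑ i ∈ Finset.Iio κ, pg w (Equiv.swap i κ) g = (κ.val : ℝ) * γ := by
    rw [Finset.sum_congr rfl (fun i hi => hγi i (Finset.mem_Iio.1 hi)), Finset.sum_const, nsmul_eq_mul,
      Fin.card_Iio]
  have key := F_avg_ge (w := w) (fun s => (hw s).le) (Finset.Iic κ) (fun j s => g (s ∘ Equiv.swap j κ))
    (fun j s => hg0 _) (F w g) γ (fun j _ => F_perm hws _ g) ?_ (Iic_ne κ)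
  · rw [Fin.card_Iic] at key
    rw [hsum]
    have : F w (R κ g) = F w (fun s => (∑ j ∈ Finset.Iic κ, g (s ∘ Equiv.swap j κ)) / ((κ.val + 1 : ℕ) : ℝ)) := by
      unfold R; rw [Fin.card_Iic]
    rw [this]
    push_cast at *
    linarith
  · intro i hi j hj hij
    rw [Finset.mem_Iic] at hi hj
    rcases hi.lt_or_eq with h | h
    · simp only [gap2_comm (g (_ ∘ Equiv.swap i κ))]
      rw [gap_inv_eq hws κ g hg i j h hj hij, hγi i h]
    · have h' : j < κ := lt_of_le_of_ne hj (fun e => hij (h.trans e.symm))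
      rw [gap_inv_eq hws κ g hg j i h' hi hij.symm, hγi j h']

theorem R_pg_mono (hw : ∀ s, 0 < w s) (hws : ∀ (σ : Equiv.Perm (Fin N)) s, w (s ∘ σ) = w s) (m κ : Fin N)
    (hm : m < κ) (g : (Fin N → X) → ℝ) (hg0 : ∀ s, 0 ≤ g s) :
    ∑ i ∈ Finset.Iio κ, pg w (Equiv.swap i κ) (R m g) ≤ ∑ i ∈ Finset.Iio κ, pg w (Equiv.swap i κ) g := by
  have hc : (0 : ℝ) < (Finset.Iic m).card := by exact_mod_cast (Iic_ne m).card_pos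
  have h1 : ∀ i ∈ Finset.Iio κ, pg w (Equiv.swap i κ) (R m g) ≤
      (∑ j ∈ Finset.Iic m, pg w (Equiv.swap i κ) (fun s => g (s ∘ Equiv.swap j m))) / ((Finset.Iic m).card : ℝ) :=
    fun i _ => pg_avg (fun s => (hw s).le) _ (Iic_ne m) _ (fun j s => g (s ∘ Equiv.swap j m)) (fun _ _ => hg0 _)
  refine (Finset.sum_le_sum h1).trans ?_
  rw [← Finset.sum_div, Finset.sum_comm, div_le_iff₀ hc]
  refine le_of_eq ?_
  rw [mul_comm, ← nsmul_eq_mul, ← Finset.sum_const]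
  refine Finset.sum_congr rfl fun j hj => ?_
  rw [Finset.mem_Iic] at hj
  have hjκ : j < κ := lt_of_le_of_lt hj hm
  have hpres : ∀ i, i < κ → Equiv.swap j m i < κ := by
    intro i hi
    rw [Equiv.swap_apply_def]
    split_ifs <;> assumption
  refine Finset.sum_bij' (fun i _ => Equiv.swap j m i) (fun i _ => Equiv.swap j m i) ?_ ?_ ?_ ?_ ?_
  · intro i hi; rw [Finset.mem_Iio] at *; exact hpres i hi
  · intro i hi; rw [Finset.mem_Iio] at *; exact hpres i hi
  · intro i _; simp
  · intro i _; simp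
  · intro i hi
    rw [pg_conj hws]
    congr 1
    rw [Equiv.swap_inv]
    have := Equiv.swap_apply_apply (Equiv.swap j m) i κ
    rw [Equiv.swap_apply_of_ne_of_ne hjκ.ne' hm.ne', Equiv.swap_inv] at this
    exact this.symm

theorem R_Gam_mono (hw : ∀ s, 0 < w s) (hws : ∀ (σ : Equiv.Perm (Fin N)) s, w (s ∘ σ) = w s) (m : Fin N)
    (g : (Fin N → X) → ℝ) (hg0 : ∀ s, 0 ≤ g s) :
    ∑ i, Gam w i (R m g) ≤ ∑ i, Gam w i g := by
  have hc : (0 : ℝ) < (Finset.Iic m).card := by exact_mod_cast (Iic_ne m).card_pos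
  have h1 : ∀ i ∈ Finset.univ, Gam w i (R m g) ≤
      (∑ j ∈ Finset.Iic m, Gam w i (fun s => g (s ∘ Equiv.swap j m))) / ((Finset.Iic m).card : ℝ) :=
    fun i _ => Gam_avg hw _ (Iic_ne m) _ (fun j s => g (s ∘ Equiv.swap j m)) (fun _ _ => hg0 _)
  refine (Finset.sum_le_sum h1).trans ?_
  rw [← Finset.sum_div, Finset.sum_comm, div_le_iff₀ hc]
  refine le_of_eq ?_
  rw [mul_comm, ← nsmul_eq_mul, ← Finset.sum_const]
  refine Finset.sum_congr rfl fun j hj => ?_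
  rw [← Equiv.sum_comp (Equiv.swap j m).symm (fun i => Gam w i g)]
  exact Finset.sum_congr rfl fun i _ => Gam_perm hws _ _ _

/-- successive symmetrization -/
theorem symmetrize (hw : ∀ s, 0 < w s) (hws : ∀ (σ : Equiv.Perm (Fin N)) s, w (s ∘ σ) = w s)
    (h : (Fin N → X) → ℝ) (hh : ∀ s, 0 ≤ h s) (k : ℕ) (hk : k ≤ N) :
    ∃ g : (Fin N → X) → ℝ, (∀ s, 0 ≤ g s) ∧ Inv k g ∧ ∑ s, w s * g s = ∑ s, w s * h s ∧
      ∑ i, Gam w i g ≤ ∑ i, Gam w i h ∧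
      (∀ κ : Fin N, k ≤ κ.val → ∑ i ∈ Finset.Iio κ, pg w (Equiv.swap i κ) g ≤
        ∑ i ∈ Finset.Iio κ, pg w (Equiv.swap i κ) h) ∧
      F w h - F w g ≤ ∑ κ ∈ Finset.univ.filter (fun κ : Fin N => κ.val < k),
        ∑ i ∈ Finset.Iio κ, pg w (Equiv.swap i κ) h := by
  induction k with
  | zero =>
    refine ⟨h, hh, ?_, rfl, le_rfl, fun _ _ => le_rfl, by simp⟩
    intro σ hσ s
    congr 1
    funext i; simp [hσ i (Nat.zero_le _)]
  | succ k ih =>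
    obtain ⟨g, g0, g1, g2, g3, g4, g5⟩ := ih (by omega)
    set κ : Fin N := ⟨k, by omega⟩ with hκ
    refine ⟨R κ g, R_nonneg κ g g0, R_inv κ g g1, (sum_R hws κ g).trans g2,
      (R_Gam_mono hw hws κ g g0).trans g3, ?_, ?_⟩
    · intro l hl
      refine (R_pg_mono hw hws κ l ?_ g g0).trans (g4 l (by omega))
      exact Fin.lt_def.2 (by simp [hκ]; omega)
    · have e : Finset.univ.filter (fun κ : Fin N => κ.val < k + 1) =
          insert κ (Finset.univ.filter (fun κ : Fin N => κ.val < k)) := by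
        ext l; simp [Fin.ext_iff, hκ]; omega
      rw [e, Finset.sum_insert (by simp [hκ])]
      have := R_step hw hws κ g g0 g1
      have := g4 κ le_rfl
      linarith

end B
end RL

namespace RL
section C
variable {X : Type*} [Fintype X]

/-- reverse Cauchy–Schwarz against the all ones vector -/
def RCS (M : X → X → ℝ) : Prop :=
  ∀ v : X → ℝ, (∑ x, ∑ y, v x * M x y * v y) * (∑ x, ∑ y, M x y) ≤ (∑ x, ∑ y, v x * M x y) ^ 2

theorem equiv_psd (r : X → X → Prop) [DecidableRel r] (hs : ∀ x y, r x y → r y x)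
    (ht : ∀ x y z, r x y → r y z → r x z) (v : X → ℝ) :
    0 ≤ ∑ x, ∑ y, v x * (if r x y then (1:ℝ) else 0) * v y := by
  let nn : X → ℝ := fun z => ∑ x, if r z x then (1:ℝ) else 0
  have key : ∀ x y, (if r x y then (1:ℝ) else 0) =
      ∑ z, (if r z x then (1:ℝ) else 0) * (if r z y then (1:ℝ) else 0) / nn z := by
    intro x y
    by_cases hxy : r x y
    · have h1 : ∀ z ∈ Finset.univ, (if r z x then (1:ℝ) else 0) * (if r z y then (1:ℝ) else 0) / nn z
          = (if r x z then (1:ℝ) else 0) / nn x := by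
        intro z _
        by_cases hz : r z x
        · have e : nn z = nn x := by
            refine Finset.sum_congr rfl fun t _ => ?_
            have : r z t ↔ r x t := ⟨fun h => ht _ _ _ (hs _ _ hz) h, fun h => ht _ _ _ hz h⟩
            simp [this]
          simp [hz, ht _ _ _ hz hxy, hs _ _ hz, e]
        · have : ¬ r x z := fun h => hz (hs _ _ h)
          simp [hz, this]
      rw [Finset.sum_congr rfl h1, ← Finset.sum_div]
      have : 0 < nn x := Finset.sum_pos' (fun z _ => by split_ifs <;> norm_num) ⟨y, Finset.mem_univ _, by simp [hxy]⟩
      rw [if_pos hxy]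
      exact (div_self this.ne').symm
    · rw [if_neg hxy]
      symm
      apply Finset.sum_eq_zero
      intro z _
      by_cases hz : r z x
      · have : ¬ r z y := fun h => hxy (ht _ _ _ (hs _ _ hz) h)
        simp [this]
      · simp [hz]
  have e : ∑ x, ∑ y, v x * (if r x y then (1:ℝ) else 0) * v y =
      ∑ z, (∑ x, (if r z x then (1:ℝ) else 0) * v x) ^ 2 / nn z := by
    have key2 : ∀ x y, v x * (if r x y then (1:ℝ) else 0) * v y = ∑ i, v x * ((if r i x then (1:ℝ) else 0) *
        (if r i y then (1:ℝ) else 0) / nn i) * v y := by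
      intro x y
      rw [← Finset.sum_mul, ← Finset.mul_sum, ← key x y]
    rw [Finset.sum_congr rfl fun x _ => Finset.sum_congr rfl fun y _ => key2 x y]
    simp only [Finset.mul_sum, Finset.sum_mul, sq, Finset.sum_div]
    rw [Finset.sum_comm]
    have : ∀ y, ∑ x, ∑ i, v x * ((if r i x then (1:ℝ) else 0) * (if r i y then (1:ℝ) else 0) / nn i) * v y
        = ∑ i, ∑ x, v x * ((if r i x then (1:ℝ) else 0) * (if r i y then (1:ℝ) else 0) / nn i) * v y :=
      fun y => Finset.sum_comm
    simp only [this]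
    rw [Finset.sum_comm]
    refine Finset.sum_congr rfl fun z _ => Finset.sum_congr rfl fun y _ => Finset.sum_congr rfl fun x _ => ?_
    ring
  rw [e]
  refine Finset.sum_nonneg fun z _ => div_nonneg (sq_nonneg _) (Finset.sum_nonneg fun x _ => ?_)
  split_ifs <;> norm_num

theorem ultra_psd (k : ℕ) : ∀ (c : X → X → ℝ), (Finset.univ.filter fun p : X × X => 0 < c p.1 p.2).card ≤ k →
    (∀ x y, 0 ≤ c x y) → (∀ x y, c x y = c y x) → (∀ x y z, min (c x y) (c y z) ≤ c x z) →
    ∀ v : X → ℝ, 0 ≤ ∑ x, ∑ y, v x * c x y * v y := by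
  classical
  induction k with
  | zero =>
    intro c hk h0 _ _ v
    have : ∀ x y, c x y = 0 := by
      intro x y
      rw [Nat.le_zero, Finset.card_eq_zero, Finset.filter_eq_empty_iff] at hk
      have := hk (Finset.mem_univ (x, y))
      simp only [not_lt] at this
      exact le_antisymm this (h0 x y)
    simp [this]
  | succ k ih =>
    intro c hk h0 hs hu v
    by_cases hne : (Finset.univ.filter fun p : X × X => 0 < c p.1 p.2).Nonempty
    swap
    · rw [Finset.not_nonempty_iff_eq_empty] at hne
      exact ih c (by rw [hne]; simp) h0 hs hu v
    obtain ⟨p, hp, hmin⟩ := Finset.exists_min_image _ (fun p : X × X => c p.1 p.2) hne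
    set m := c p.1 p.2 with hm
    have hm0 : 0 < m := (Finset.mem_filter.1 hp).2
    have hmin' : ∀ x y, 0 < c x y → m ≤ c x y := fun x y h => hmin (x, y) (by simp [h])
    let c' : X → X → ℝ := fun x y => max (c x y - m) 0
    have hc' : ∀ x y, c x y = c' x y + m * (if 0 < c x y then (1:ℝ) else 0) := by
      intro x y
      by_cases h : 0 < c x y
      · have := hmin' x y h
        simp only [c', if_pos h]
        rw [max_eq_left (by linarith)]; ring
      · have : c x y = 0 := le_antisymm (not_lt.1 h) (h0 x y)
        simp only [c', this]
        rw [max_eq_right (by linarith)]; simp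
    have i1 := ih c' ?_ (fun x y => le_max_right _ _) (fun x y => by simp only [c', hs x y]) ?_ v
    · have i2 := equiv_psd (fun x y => 0 < c x y) (fun x y h => by rw [hs]; exact h)
        (fun x y z h1 h2 => lt_of_lt_of_le (lt_min h1 h2) (hu x y z)) v
      have e : ∑ x, ∑ y, v x * c x y * v y = ∑ x, ∑ y, v x * c' x y * v y +
          m * ∑ x, ∑ y, v x * (if 0 < c x y then (1:ℝ) else 0) * v y := by
        rw [Finset.mul_sum, ← Finset.sum_add_distrib]
        refine Finset.sum_congr rfl fun x _ => ?_
        rw [Finset.mul_sum, ← Finset.sum_add_distrib]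
        refine Finset.sum_congr rfl fun y _ => ?_
        conv_lhs => rw [hc' x y]
        ring
      rw [e]
      positivity
    · refine Nat.le_of_lt_succ (lt_of_lt_of_le (Finset.card_lt_card ?_) hk)
      rw [Finset.ssubset_iff_of_subset]
      · exact ⟨p, hp, by simp [c', ← hm]⟩
      · intro q hq
        simp only [Finset.mem_filter, Finset.mem_univ, true_and, c', lt_max_iff, lt_irrefl, or_false] at hq ⊢
        linarith
    · intro x y z
      have := hu x y z
      simp only [c']
      rcases min_le_iff.1 this with h | h
      · exact (min_le_left _ _).trans (max_le_max (by linarith) le_rfl)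
      · exact (min_le_right _ _).trans (max_le_max (by linarith) le_rfl)

theorem ultra_neg (b : X → X → ℝ) (hs : ∀ x y, b x y = b y x)
    (hu : ∀ x y z, b x z ≤ max (b x y) (b y z)) (v : X → ℝ) (hv : ∑ x, v x = 0) :
    ∑ x, ∑ y, v x * b x y * v y ≤ 0 := by
  obtain ⟨C, hbC⟩ : ∃ C : ℝ, ∀ x y, b x y ≤ C := ⟨∑ x, ∑ y, |b x y|, fun x y =>
    (le_abs_self _).trans ((Finset.single_le_sum (f := fun y => |b x y|) (fun _ _ => abs_nonneg _) (Finset.mem_univ y)).trans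
      (Finset.single_le_sum (f := fun x => ∑ y, |b x y|) (fun _ _ => Finset.sum_nonneg fun _ _ => abs_nonneg _) (Finset.mem_univ x)))⟩
  have := ultra_psd _ (fun x y => C - b x y) le_rfl (fun x y => by linarith [hbC x y])
    (fun x y => by rw [hs]) (fun x y z => by
      rcases le_max_iff.1 (hu x y z) with h | h
      · exact (min_le_left _ _).trans (by linarith)
      · exact (min_le_right _ _).trans (by linarith)) v
  have e : ∑ x, ∑ y, v x * (C - b x y) * v y = C * (∑ x, v x) * (∑ y, v y) - ∑ x, ∑ y, v x * b x y * v y := by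
    rw [Finset.mul_sum, ← Finset.sum_sub_distrib]
    refine Finset.sum_congr rfl fun x _ => ?_
    rw [mul_assoc, Finset.sum_mul, Finset.mul_sum, ← Finset.sum_sub_distrib]
    exact Finset.sum_congr rfl fun y _ => by ring
  rw [e, hv] at this
  linarith

theorem RCS_of_four_point [Nonempty X] (a : X → X → ℝ) (ha : ∀ x y, 0 < a x y) (hs : ∀ x y, a x y = a y x)
    (h4 : ∀ x y z t, a x y * a z t ≤ max (a x z * a y t) (a x t * a y z)) : RCS a := by
  intro h
  obtain ⟨o⟩ := ‹Nonempty X›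
  let b : X → X → ℝ := fun x y => a x y / (a x o * a y o)
  have hu : ∀ x y z, b x z ≤ max (b x y) (b y z) := by
    intro x y z
    have h1 := h4 x z y o
    have p1 := ha x o; have p2 := ha y o; have p3 := ha z o
    simp only [b]
    rcases le_max_iff.1 h1 with h | h
    · refine le_max_of_le_left ?_
      rw [div_le_div_iff₀ (by positivity) (by positivity)]
      nlinarith [mul_le_mul_of_nonneg_left h p1.le]
    · refine le_max_of_le_right ?_
      rw [div_le_div_iff₀ (by positivity) (by positivity), hs y z]
      nlinarith [mul_le_mul_of_nonneg_left h p3.le]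
  let L : (X → ℝ) → ℝ := fun v => ∑ x, v x * a x o
  have hL1 : 0 < L (fun _ => 1) := Finset.sum_pos (fun x _ => by simpa using ha x o) ⟨o, Finset.mem_univ _⟩
  set c := L h / L (fun _ => 1) with hc
  have k := ultra_neg b (fun x y => by simp only [b, hs x y, mul_comm]) hu (fun x => (h x - c) * a x o) (by
    have : ∑ x, (h x - c) * a x o = L h - c * L (fun _ => 1) := by
      simp only [L, Finset.mul_sum, ← Finset.sum_sub_distrib]
      exact Finset.sum_congr rfl fun x _ => by ring
    rw [this, hc]; field_simp; ring)
  have e : ∑ x, ∑ y, (h x - c) * a x o * b x y * ((h y - c) * a y o) =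
      ∑ x, ∑ y, h x * a x y * h y - 2 * c * ∑ x, ∑ y, h x * a x y + c ^ 2 * ∑ x, ∑ y, a x y := by
    have e1 : ∑ x, ∑ y, (h x - c) * a x o * b x y * ((h y - c) * a y o) =
        ∑ x, ∑ y, (h x * a x y * h y - c * (h x * a x y) - c * (h y * a y x) + c ^ 2 * a x y) := by
      refine Finset.sum_congr rfl fun x _ => Finset.sum_congr rfl fun y _ => ?_
      have p1 := (ha x o).ne'; have p2 := (ha y o).ne'
      simp only [b]; rw [hs y x]
      field_simp; ring
    rw [e1]
    simp only [Finset.sum_add_distrib, Finset.sum_sub_distrib, ← Finset.mul_sum]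
    rw [Finset.sum_comm (f := fun x y => h y * a y x)]
    simp only [← Finset.mul_sum]
    ring
  rw [e] at k
  have hS : 0 ≤ ∑ x, ∑ y, a x y := Finset.sum_nonneg fun x _ => Finset.sum_nonneg fun y _ => (ha x y).le
  set S := ∑ x, ∑ y, a x y
  set p := ∑ x, ∑ y, h x * a x y
  set Qh := ∑ x, ∑ y, h x * a x y * h y
  nlinarith [mul_le_mul_of_nonneg_left k hS, sq_nonneg (S * c - p)]

end C
end RL

namespace RL
section D
variable {X : Type*} [Fintype X]

theorem RCS_trickle (M : X → X → ℝ) (hM : ∀ x y, 0 < M x y) (hs : ∀ x y, M x y = M y x)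
    (hT : ∀ v : X → ℝ, ∑ x, ∑ y, v x * M x y * v y ≤ ∑ z, (∑ y, M z y * v y) ^ 2 / ∑ y, M z y) : RCS M := by
  classical
  rcases isEmpty_or_nonempty X with hX | hX
  · intro v; simp
  set D : X → ℝ := fun z => ∑ y, M z y with hD
  have hD0 : ∀ z, 0 < D z := fun z => Finset.sum_pos (fun y _ => hM z y) Finset.univ_nonempty
  set S := ∑ z, D z with hS
  have hS0 : 0 < S := Finset.sum_pos (fun z _ => hD0 z) Finset.univ_nonempty
  set q : X → ℝ := fun z => Real.sqrt (D z) with hq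
  have hq0 : ∀ z, 0 < q z := fun z => Real.sqrt_pos.2 (hD0 z)
  have hqq : ∀ z, q z * q z = D z := fun z => Real.mul_self_sqrt (hD0 z).le
  let A : Matrix X X ℝ := Matrix.of fun x y => q x * q y / S - M x y / (q x * q y)
  have hA : A.IsHermitian := by
    ext x y
    simp only [A, Matrix.conjTranspose_apply, Matrix.of_apply, star_trivial]
    rw [hs y x, mul_comm (q y)]
  have hpsd : A.PosSemidef := by
    rw [hA.posSemidef_iff_eigenvalues_nonneg]
    intro j
    by_contra hneg
    simp only [Pi.zero_apply, not_le] at hneg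
    set l := - hA.eigenvalues j with hl
    have hl0 : 0 < l := by linarith
    let e : X → ℝ := (hA.eigenvectorBasis j).ofLp
    have he : A.mulVec e = hA.eigenvalues j • e := hA.mulVec_eigenvectorBasis j
    have hene : e ≠ 0 := by
      intro h0
      have h1 := hA.eigenvectorBasis.orthonormal.ne_zero j
      apply h1
      ext x
      exact congrFun h0 x
    let v : X → ℝ := fun x => e x / q x
    have hev : ∀ x, e x = q x * v x := fun x => by
      simp only [v]; have := (hq0 x).ne'; field_simp
    have hvne : v ≠ 0 := by
      intro h0; apply hene; funext x; rw [hev, h0]; simp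
    -- eigen equation
    have eig : ∀ x, ∑ y, M x y * v y - D x * (∑ y, D y * v y) / S = l * D x * v x := by
      intro x
      have h1 := congrFun he x
      simp only [Matrix.mulVec, dotProduct, A, Matrix.of_apply, Pi.smul_apply, smul_eq_mul] at h1
      have h2 : ∑ y, (q x * q y / S - M x y / (q x * q y)) * e y =
          (q x * (∑ y, D y * v y) / S - (∑ y, M x y * v y) / q x) := by
        rw [Finset.mul_sum, Finset.sum_div, Finset.sum_div, ← Finset.sum_sub_distrib]
        refine Finset.sum_congr rfl fun y _ => ?_
        rw [hev y, ← hqq y]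
        have := (hq0 x).ne'; have := (hq0 y).ne'
        field_simp
      rw [h2, hev x] at h1
      have h3 := congrArg (fun t => - q x * t) h1
      beta_reduce at h3
      have h4 : hA.eigenvalues j = - l := by rw [hl]; ring
      rw [h4] at h3
      have h5 : -q x * (q x * (∑ y, D y * v y) / S - (∑ y, M x y * v y) / q x) =
          ∑ y, M x y * v y - (q x * q x) * (∑ y, D y * v y) / S := by
        have := (hq0 x).ne'
        field_simp; ring
      rw [h5, hqq] at h3
      rw [h3, ← hqq x]; ring
    have hzero : ∑ y, D y * v y = 0 := by
      have h1 := Finset.sum_congr rfl (fun x (_ : x ∈ Finset.univ) => eig x)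
      rw [Finset.sum_sub_distrib, Finset.sum_comm, ← Finset.sum_div, ← Finset.sum_mul, ← hS] at h1
      have h2 : ∑ y, ∑ x, M x y * v y = ∑ y, D y * v y := by
        refine Finset.sum_congr rfl fun y _ => ?_
        rw [← Finset.sum_mul]; congr 1
        exact Finset.sum_congr rfl fun x _ => hs x y
      have h3 : ∑ x, l * D x * v x = l * ∑ y, D y * v y := by
        rw [Finset.mul_sum]; exact Finset.sum_congr rfl fun x _ => by ring
      rw [h2, h3] at h1
      have h4 : S * (∑ y, D y * v y) / S = ∑ y, D y * v y := by field_simp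
      rw [h4, sub_self] at h1
      exact (mul_eq_zero.1 h1.symm).resolve_left hl0.ne'
    have eig' : ∀ x, ∑ y, M x y * v y = l * D x * v x := by
      intro x; have := eig x; rw [hzero] at this; simpa using this
    -- l ≥ 1
    obtain ⟨x0, hx0⟩ := Function.ne_iff.1 hvne
    have hE : 0 < ∑ x, D x * v x ^ 2 := by
      refine Finset.sum_pos' (fun x _ => mul_nonneg (hD0 x).le (sq_nonneg _)) ⟨x0, Finset.mem_univ _, ?_⟩
      exact mul_pos (hD0 x0) (by have h0 : v x0 ≠ 0 := hx0; positivity)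
    have hl1 : 1 ≤ l := by
      have h1 := hT v
      have h2 : ∑ x, ∑ y, v x * M x y * v y = l * ∑ x, D x * v x ^ 2 := by
        rw [Finset.mul_sum]
        refine Finset.sum_congr rfl fun x _ => ?_
        have : ∑ y, v x * M x y * v y = v x * ∑ y, M x y * v y := by
          rw [Finset.mul_sum]; exact Finset.sum_congr rfl fun y _ => by ring
        rw [this, eig']; ring
      have h3 : ∑ z, (∑ y, M z y * v y) ^ 2 / ∑ y, M z y = l ^ 2 * ∑ x, D x * v x ^ 2 := by
        rw [Finset.mul_sum]
        refine Finset.sum_congr rfl fun x _ => ?_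
        rw [eig']
        have : ∑ y, M x y = D x := rfl
        rw [this]
        have := (hD0 x).ne'
        field_simp
      rw [h2, h3] at h1
      have := le_of_mul_le_mul_right h1 hE
      nlinarith
    -- maximum argument
    obtain ⟨x, _, hx⟩ := Finset.exists_max_image Finset.univ v Finset.univ_nonempty
    have hex : ∃ y, v y < v x := by
      by_contra hcon
      push Not at hcon
      have hall : ∀ y, v y = v x := fun y => le_antisymm (hx y (Finset.mem_univ _)) (hcon y)
      have : ∑ y, D y * v y = S * v x := by
        rw [hS, Finset.sum_mul]; exact Finset.sum_congr rfl fun y _ => by rw [hall y]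
      rw [this] at hzero
      have h0 := (mul_eq_zero.1 hzero).resolve_left hS0.ne'
      exact hx0 (by rw [hall x0, h0]; rfl)
    obtain ⟨y, hy⟩ := hex
    have hpos : 0 < v x := by
      by_contra hcon
      push Not at hcon
      have : ∑ y, D y * v y < 0 := by
        refine Finset.sum_neg' (fun z _ => ?_) ⟨y, Finset.mem_univ _, ?_⟩
        · exact mul_nonpos_of_nonneg_of_nonpos (hD0 z).le ((hx z (Finset.mem_univ _)).trans hcon)
        · exact mul_neg_of_pos_of_neg (hD0 y) (hy.trans_le hcon)
      linarith
    have hlt : ∑ y, M x y * v y < ∑ y, M x y * v x :=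
      Finset.sum_lt_sum (fun z _ => mul_le_mul_of_nonneg_left (hx z (Finset.mem_univ _)) (hM x z).le)
        ⟨y, Finset.mem_univ _, mul_lt_mul_of_pos_left hy (hM x y)⟩
    rw [eig', ← Finset.sum_mul] at hlt
    have : D x * v x ≤ l * D x * v x := by
      have := mul_pos (hD0 x) hpos
      nlinarith
    exact absurd hlt (not_lt.2 this)
  intro v
  have h1 := hpsd.dotProduct_mulVec_nonneg (fun x => q x * v x)
  have h2 : star (fun x => q x * v x) ⬝ᵥ A.mulVec (fun x => q x * v x) =
      (∑ x, D x * v x) * (∑ x, D x * v x) / S - ∑ x, ∑ y, v x * M x y * v y := by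
    simp only [Matrix.mulVec, dotProduct, A, Matrix.of_apply, Pi.star_apply, star_trivial]
    rw [Finset.sum_mul_sum, Finset.sum_div, ← Finset.sum_sub_distrib]
    refine Finset.sum_congr rfl fun x _ => ?_
    rw [Finset.mul_sum, Finset.sum_div, ← Finset.sum_sub_distrib]
    refine Finset.sum_congr rfl fun y _ => ?_
    rw [← hqq x, ← hqq y]
    have := (hq0 x).ne'; have := (hq0 y).ne'
    field_simp
  rw [h2] at h1
  have h3 : ∑ x, ∑ y, v x * M x y = ∑ x, D x * v x := by
    refine Finset.sum_congr rfl fun x _ => ?_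
    rw [← Finset.mul_sum, mul_comm]
  rw [h3]
  have h4 : (∑ x, D x * v x) * (∑ x, D x * v x) / S * S = (∑ x, D x * v x) ^ 2 := by field_simp
  change _ * S ≤ _
  nlinarith [mul_le_mul_of_nonneg_right (sub_nonneg.1 h1) hS0.le]

/-- marginals of a symmetric weight -/
noncomputable def U (g : Multiset X → ℝ) : ℕ → Multiset X → ℝ
  | 0, σ => g σ
  | m + 1, σ => ∑ x, U g m (x ::ₘ σ)

theorem U_nonneg (g : Multiset X → ℝ) (hg : ∀ σ, 0 ≤ g σ) (m : ℕ) : ∀ σ, 0 ≤ U g m σ := by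
  induction m with
  | zero => exact hg
  | succ m ih => exact fun σ => Finset.sum_nonneg fun x _ => ih _

theorem U_pos [Nonempty X] (g : Multiset X → ℝ) (hg : ∀ σ, 0 < g σ) (m : ℕ) : ∀ σ, 0 < U g m σ := by
  induction m with
  | zero => exact hg
  | succ m ih => exact fun σ => Finset.sum_pos (fun x _ => ih _) Finset.univ_nonempty

theorem RCS_U [Nonempty X] (g : Multiset X → ℝ) (hg : ∀ σ, 0 < g σ) (n : ℕ)
    (hb : ∀ σ : Multiset X, Multiset.card σ + 2 = n → RCS (fun x y => g (x ::ₘ y ::ₘ σ))) (m : ℕ) :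
    ∀ σ : Multiset X, Multiset.card σ + m + 2 = n → RCS (fun x y => U g m (x ::ₘ y ::ₘ σ)) := by
  induction m with
  | zero => intro σ hσ; exact hb σ hσ
  | succ m ih =>
    intro σ hσ
    apply RCS_trickle
    · exact fun x y => U_pos g hg _ _
    · intro x y; simp only [Multiset.cons_swap x y]
    · intro v
      have h1 : ∀ z, ∑ x, ∑ y, v x * U g m (x ::ₘ y ::ₘ z ::ₘ σ) * v y ≤
          (∑ y, U g (m + 1) (z ::ₘ y ::ₘ σ) * v y) ^ 2 / ∑ y, U g (m + 1) (z ::ₘ y ::ₘ σ) := by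
        intro z
        have h2 := ih (z ::ₘ σ) (by rw [Multiset.card_cons]; omega) v
        have h3 : ∀ x, ∑ y, U g m (x ::ₘ y ::ₘ z ::ₘ σ) = U g (m + 1) (z ::ₘ x ::ₘ σ) := by
          intro x
          simp only [U]
          refine Finset.sum_congr rfl fun y _ => ?_
          rw [Multiset.cons_swap x y, Multiset.cons_swap x z]
        have h4 : ∑ x, ∑ y, v x * U g m (x ::ₘ y ::ₘ z ::ₘ σ) = ∑ y, U g (m + 1) (z ::ₘ y ::ₘ σ) * v y := by
          refine Finset.sum_congr rfl fun x _ => ?_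
          rw [← Finset.mul_sum, h3, mul_comm]
        rw [h4] at h2
        simp only [h3] at h2
        rw [le_div_iff₀ (Finset.sum_pos (fun y _ => U_pos g hg _ _) Finset.univ_nonempty)]
        exact h2
      refine le_trans (le_of_eq ?_) (Finset.sum_le_sum fun z _ => h1 z)
      have h5 : ∀ x y, v x * U g (m + 1) (x ::ₘ y ::ₘ σ) * v y = ∑ z, v x * U g m (x ::ₘ y ::ₘ z ::ₘ σ) * v y := by
        intro x y
        rw [← Finset.sum_mul, ← Finset.mul_sum]
        simp only [U]
        congr 2
        refine Finset.sum_congr rfl fun z _ => ?_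
        rw [Multiset.cons_swap z x, Multiset.cons_swap z y]
      simp only [h5]
      rw [Finset.sum_comm]
      have : ∀ y, ∑ x, ∑ z, v x * U g m (x ::ₘ y ::ₘ z ::ₘ σ) * v y
          = ∑ z, ∑ x, v x * U g m (x ::ₘ y ::ₘ z ::ₘ σ) * v y := fun y => Finset.sum_comm
      simp only [this]
      rw [Finset.sum_comm]
      exact Finset.sum_congr rfl fun z _ => Finset.sum_comm

theorem two_step [Nonempty X] (M V : X → X → ℝ) (hM : ∀ x y, 0 < M x y) (hMs : ∀ x y, M x y = M y x)
    (hV : ∀ x y, 0 ≤ V x y) (hVs : ∀ x y, V x y = V y x) (hR : RCS M) :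
    0 ≤ ∑ x, ∑ y, th (V x y) (M x y) - 2 * ∑ x, th (∑ y, V x y) (∑ y, M x y) +
      th (∑ x, ∑ y, V x y) (∑ x, ∑ y, M x y) := by
  set u : X → ℝ := fun x => ∑ y, M x y with hu
  set v : X → ℝ := fun x => ∑ y, V x y with hv
  have hu0 : ∀ x, 0 < u x := fun x => Finset.sum_pos (fun y _ => hM x y) Finset.univ_nonempty
  have hv0 : ∀ x, 0 ≤ v x := fun x => Finset.sum_nonneg (fun y _ => hV x y)
  change 0 ≤ ∑ x, ∑ y, th (V x y) (M x y) - 2 * ∑ x, th (v x) (u x) + th (∑ x, v x) (∑ x, u x)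
  have hR' := hR (fun x => v x / u x)
  change _ * (∑ x, u x) ≤ _ at hR'
  have hU0 : 0 < ∑ x, u x := Finset.sum_pos (fun x _ => hu0 x) Finset.univ_nonempty
  have e1 : ∑ x, ∑ y, v x / u x * M x y = ∑ x, v x := by
    refine Finset.sum_congr rfl fun x _ => ?_
    rw [← Finset.mul_sum]
    change v x / u x * u x = v x
    have := (hu0 x).ne'
    field_simp
  beta_reduce at hR'
  rw [e1] at hR'
  set u0 := ∑ x, u x with hu0d
  set v0 := ∑ x, v x with hv0d
  have hv00 : 0 ≤ v0 := Finset.sum_nonneg fun x _ => hv0 x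
  rcases hv00.eq_or_lt with hz | hp
  · have z1 : ∀ x, v x = 0 := fun x => (Finset.sum_eq_zero_iff_of_nonneg (fun x _ => hv0 x)).1 hz.symm x (Finset.mem_univ _)
    have z2 : ∀ x y, V x y = 0 := fun x y => (Finset.sum_eq_zero_iff_of_nonneg (fun y _ => hV x y)).1 (z1 x) y (Finset.mem_univ _)
    simp [th, z1, z2, ← hz]
  have pt : ∀ x y, V x y * (Real.log (v x) - Real.log (u x)) + V x y * (Real.log (v y) - Real.log (u y))
      - V x y * (Real.log v0 - Real.log u0) + V x y - (v x / u x * M x y * (v y / u y)) * (u0 / v0)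
      ≤ th (V x y) (M x y) := by
    intro x y
    have hux := hu0 x; have huy := hu0 y
    rcases (hV x y).eq_or_lt with h | h
    · rw [← h]
      have := hM x y; have := hv0 x; have := hv0 y
      have : 0 ≤ (v x / u x * M x y * (v y / u y)) * (u0 / v0) := by positivity
      simp only [th, zero_mul]; linarith
    · have hvx : 0 < v x := lt_of_lt_of_le h (Finset.single_le_sum (f := fun y => V x y) (fun y _ => hV x y) (Finset.mem_univ y))
      have hvy : 0 < v y := lt_of_lt_of_le (by rw [hVs y x]; exact h)
        (Finset.single_le_sum (f := fun z => V y z) (fun z _ => hV y z) (Finset.mem_univ x))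
      have := th_ge (V x y) (M x y) (v x / u x * (v y / u y) * (u0 / v0)) h.le (hM x y).le
        (fun h0 => absurd h0 (hM x y).ne') (by positivity)
      rw [Real.log_mul (by positivity) (by positivity), Real.log_mul (by positivity) (by positivity),
        Real.log_div hvx.ne' hux.ne', Real.log_div hvy.ne' huy.ne', Real.log_div hU0.ne' hp.ne'] at this
      refine le_trans (le_of_eq ?_) this
      ring
  have tot := Finset.sum_le_sum fun x (_ : x ∈ Finset.univ) =>
    Finset.sum_le_sum fun y (_ : y ∈ Finset.univ) => pt x y
  have s1 : ∑ x, ∑ y, V x y * (Real.log (v x) - Real.log (u x)) = ∑ x, th (v x) (u x) :=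
    Finset.sum_congr rfl fun x _ => by rw [← Finset.sum_mul]; rfl
  have s2 : ∑ x, ∑ y, V x y * (Real.log (v y) - Real.log (u y)) = ∑ x, th (v x) (u x) := by
    rw [Finset.sum_comm]
    refine Finset.sum_congr rfl fun y _ => ?_
    rw [← Finset.sum_mul]
    simp only [hVs _ y]; rfl
  have s3 : ∑ x, ∑ y, V x y * (Real.log v0 - Real.log u0) = th v0 u0 := by
    simp only [← Finset.sum_mul]; rfl
  have s4 : ∑ x, ∑ y, V x y = v0 := rfl
  simp only [Finset.sum_sub_distrib, Finset.sum_add_distrib] at tot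
  have s5 : ∑ x, ∑ y, v x / u x * M x y * (v y / u y) * (u0 / v0) =
      (∑ x, ∑ y, v x / u x * M x y * (v y / u y)) * (u0 / v0) := by
    simp only [Finset.sum_mul]
  rw [s5, s4, s1, s2, s3] at tot
  have s6 : (∑ x, ∑ y, v x / u x * M x y * (v y / u y)) * (u0 / v0) ≤ v0 := by
    rw [← mul_div_assoc, div_le_iff₀ hp]; nlinarith
  linarith

end D
end RL

namespace RL
section E1
variable {X : Type*} [Fintype X]

theorem count_ofFn' {N : ℕ} [DecidableEq X] (s : Fin N → X) (p : X) :
    Multiset.count p (↑(List.ofFn s) : Multiset X) = (Finset.univ.filter fun i => s i = p).card := by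
  have e : (↑(List.ofFn s) : Multiset X) = Multiset.map s Finset.univ.val := by
    rw [List.ofFn_eq_map]; rfl
  rw [e, Multiset.count_map, Finset.card_def, Finset.filter_val]
  congr 1
  exact Multiset.filter_congr fun i _ => eq_comm

theorem exists_perm_of_ofFn {N : ℕ} (s s' : Fin N → X)
    (h : (↑(List.ofFn s) : Multiset X) = ↑(List.ofFn s')) : ∃ σ : Equiv.Perm (Fin N), s = s' ∘ σ := by
  classical
  have hc : ∀ p, Nonempty ({i // s i = p} ≃ {i // s' i = p}) := by
    intro p
    have h1 := count_ofFn' s p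
    rw [h, count_ofFn'] at h1
    apply Fintype.card_eq.1
    rw [Fintype.card_subtype, Fintype.card_subtype]
    exact h1.symm
  let e : ∀ p, {i // s i = p} ≃ {i // s' i = p} := fun p => (hc p).some
  refine ⟨Equiv.ofFiberEquiv e, ?_⟩
  funext i
  exact (Equiv.ofFiberEquiv_map e i).symm

theorem exists_multiset_fun {N : ℕ} (h : (Fin N → X) → ℝ) (hh : ∀ s, 0 ≤ h s)
    (hs : ∀ (σ : Equiv.Perm (Fin N)) s, h (s ∘ σ) = h s) :
    ∃ f : Multiset X → ℝ, (∀ σ, 0 ≤ f σ) ∧ ∀ s, h s = f ↑(List.ofFn s) := by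
  classical
  refine ⟨fun m => if H : ∃ s : Fin N → X, (↑(List.ofFn s) : Multiset X) = m then h H.choose else 0, ?_, ?_⟩
  · intro σ; dsimp only; split_ifs
    · exact hh _
    · exact le_rfl
  · intro s
    have H : ∃ s' : Fin N → X, (↑(List.ofFn s') : Multiset X) = ↑(List.ofFn s) := ⟨s, rfl⟩
    dsimp only
    rw [dif_pos H]
    obtain ⟨σ, hσ⟩ := exists_perm_of_ofFn _ _ H.choose_spec
    rw [hσ, hs]

theorem sum_cons {N : ℕ} (f : (Fin (N + 1) → X) → ℝ) :
    ∑ s, f s = ∑ x, ∑ s : Fin N → X, f (Fin.cons x s) := by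
  rw [← Fintype.sum_prod_type' (f := fun x (s : Fin N → X) => f (Fin.cons x s))]
  exact (Fintype.sum_equiv (Fin.consEquiv (fun _ : Fin (N + 1) => X)) _ _ (fun p => rfl)).symm

theorem U_eq (f : Multiset X → ℝ) (j : ℕ) : ∀ σ, U f j σ = ∑ s : Fin j → X, f (↑(List.ofFn s) + σ) := by
  induction j with
  | zero => intro σ; simp [U]
  | succ j ih =>
    intro σ
    rw [sum_cons]
    simp only [U, ih]
    refine Finset.sum_congr rfl fun x _ => Finset.sum_congr rfl fun s _ => ?_
    congr 1
    rw [List.ofFn_cons, ← Multiset.cons_coe, Multiset.cons_add, Multiset.add_cons]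

theorem K_conv [Nonempty X] (b a : Multiset X → ℝ) (hb : ∀ σ, 0 < b σ) (ha : ∀ σ, 0 ≤ a σ) (n : ℕ)
    (hR : ∀ σ : Multiset X, Multiset.card σ + 2 = n → RCS (fun x y => b (x ::ₘ y ::ₘ σ))) (j : ℕ) :
    ∀ (m : ℕ) (σ : Multiset X), Multiset.card σ + j + m + 2 = n →
      0 ≤ U (fun τ => th (U a m τ) (U b m τ)) (j + 2) σ
        - 2 * U (fun τ => th (U a (m + 1) τ) (U b (m + 1) τ)) (j + 1) σ
        + U (fun τ => th (U a (m + 2) τ) (U b (m + 2) τ)) j σ := by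
  induction j with
  | zero =>
    intro m σ hσ
    have h1 := RCS_U b hb n hR m σ (by omega)
    have := two_step (fun x y => U b m (y ::ₘ x ::ₘ σ)) (fun x y => U a m (y ::ₘ x ::ₘ σ))
      (fun x y => U_pos b hb _ _) (fun x y => by rw [Multiset.cons_swap]) (fun x y => U_nonneg a ha _ _)
      (fun x y => by rw [Multiset.cons_swap]) (by
        have e : (fun x y => U b m (y ::ₘ x ::ₘ σ)) = fun x y => U b m (x ::ₘ y ::ₘ σ) := by
          funext x y; rw [Multiset.cons_swap]
        rw [e]; exact h1)
    exact this
  | succ j ih =>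
    intro m σ hσ
    have h1 : 0 ≤ ∑ x, (U (fun τ => th (U a m τ) (U b m τ)) (j + 2) (x ::ₘ σ)
        - 2 * U (fun τ => th (U a (m + 1) τ) (U b (m + 1) τ)) (j + 1) (x ::ₘ σ)
        + U (fun τ => th (U a (m + 2) τ) (U b (m + 2) τ)) j (x ::ₘ σ)) :=
      Finset.sum_nonneg fun x _ => ih m (x ::ₘ σ) (by rw [Multiset.card_cons]; omega)
    rw [Finset.sum_add_distrib, Finset.sum_sub_distrib, ← Finset.mul_sum] at h1
    exact h1

theorem K_mlsi [Nonempty X] (b a : Multiset X → ℝ) (hb : ∀ σ, 0 < b σ) (ha : ∀ σ, 0 ≤ a σ) (n : ℕ)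
    (hR : ∀ σ : Multiset X, Multiset.card σ + 2 = n → RCS (fun x y => b (x ::ₘ y ::ₘ σ)))
    (hb1 : U b n 0 = 1) (ha1 : U a n 0 = 1) (k : ℕ) : ∀ m, k + 1 + m = n →
      ((k : ℝ) + 1) * U (fun τ => th (U a (m + 1) τ) (U b (m + 1) τ)) k 0 ≤
        (k : ℝ) * U (fun τ => th (U a m τ) (U b m τ)) (k + 1) 0 := by
  induction k with
  | zero =>
    intro m hm
    have : m + 1 = n := by omega
    rw [this]
    simp only [U.eq_1, hb1, ha1]
    simp [th]
  | succ k ih =>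
    intro m hm
    have h1 := ih (m + 1) (by omega)
    have h2 := K_conv b a hb ha n hR k m 0 (by simp; omega)
    have hk : (0 : ℝ) ≤ k := Nat.cast_nonneg k
    push_cast
    have h3 := mul_nonneg (show (0:ℝ) ≤ k + 1 by linarith) h2
    have e : k + 1 + 1 = k + 2 := rfl
    rw [e]
    have e2 : m + 1 + 1 = m + 2 := rfl
    rw [e2] at h1
    nlinarith

theorem mlsi_sym {N : ℕ} [Nonempty X] (w h : (Fin (N + 1) → X) → ℝ) (b : Multiset X → ℝ) (hb : ∀ σ, 0 < b σ)
    (hwb : ∀ s, w s = b ↑(List.ofFn s))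
    (hR : ∀ σ : Multiset X, Multiset.card σ + 2 = N + 1 → RCS (fun x y => b (x ::ₘ y ::ₘ σ)))
    (hw1 : ∑ s, w s = 1) (hh : ∀ s, 0 ≤ h s) (hh1 : ∑ s, w s * h s = 1)
    (hs : ∀ (σ : Equiv.Perm (Fin (N + 1))) s, h (s ∘ σ) = h s) :
    ((N : ℝ) + 1) * F w (Gi w 0 h) ≤ N * F w h := by
  obtain ⟨f, hf, hhf⟩ := exists_multiset_fun h hh hs
  have hw : ∀ s, 0 < w s := fun s => by rw [hwb]; exact hb _
  have key := K_mlsi b (fun m => b m * f m) hb (fun m => mul_nonneg (hb m).le (hf m)) (N + 1) hR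
    (by rw [U_eq]; simpa [hwb] using hw1) (by rw [U_eq]; simpa [hwb, hhf] using hh1) N 0 (by omega)
  have e1 : U (fun τ => th (U (fun m => b m * f m) 0 τ) (U b 0 τ)) (N + 1) 0 = F w h := by
    rw [U_eq]
    unfold F
    refine Finset.sum_congr rfl fun s _ => ?_
    simp only [U, add_zero, ← hwb, ← hhf]
    unfold th phi
    by_cases h0 : h s = 0
    · simp [h0]
    · rw [Real.log_mul (hw s).ne' h0]; ring
  have e2 : U (fun τ => th (U (fun m => b m * f m) (0 + 1) τ) (U b (0 + 1) τ)) N 0 = F w (Gi w 0 h) := by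
    rw [U_eq]
    unfold F
    rw [sum_cons, Finset.sum_comm]
    refine Finset.sum_congr rfl fun s _ => ?_
    have g1 : ∀ x, (x ::ₘ (↑(List.ofFn s) : Multiset X)) = ↑(List.ofFn (Fin.cons x s : Fin (N + 1) → X)) := by
      intro x; rw [List.ofFn_cons]; rfl
    simp only [U, add_zero, g1, ← hwb, ← hhf]
    have g2 : ∀ x, Gi w 0 h (Fin.cons x s) = (∑ r, w (Fin.cons r s) * h (Fin.cons r s)) / ∑ r, w (Fin.cons r s) := by
      intro x; unfold Gi; simp only [Fin.update_cons_zero]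
    simp only [g2]
    rw [← Finset.sum_mul]
    have hB : 0 < ∑ r, w (Fin.cons r s) := Finset.sum_pos (fun _ _ => hw _) Finset.univ_nonempty
    set A := ∑ r, w (Fin.cons r s) * h (Fin.cons r s)
    set B := ∑ r, w (Fin.cons r s)
    unfold th phi
    by_cases h0 : A = 0
    · simp [h0]
    · rw [Real.log_div h0 hB.ne']; field_simp
  rw [e1, e2] at key
  exact key

end E1
end RL

namespace RL
section G1
variable {N : ℕ} {X : Type*} [Fintype X] {w : (Fin N → X) → ℝ}

theorem gap2_nonneg (a b : ℝ) (ha : 0 ≤ a) (hb : 0 ≤ b) : 0 ≤ gap2 a b := by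
  have := phi_convex2 a b (1/2) (1/2) ha hb (by norm_num) (by norm_num) (by norm_num)
  unfold gap2
  have e : (a + b) / 2 = 1 / 2 * a + 1 / 2 * b := by ring
  rw [e]; linarith

theorem pg_nonneg (hw : ∀ s, 0 ≤ w s) (σ : Equiv.Perm (Fin N)) (h : (Fin N → X) → ℝ) (hh : ∀ s, 0 ≤ h s) :
    0 ≤ pg w σ h :=
  Finset.sum_nonneg fun s _ => mul_nonneg (hw s) (gap2_nonneg _ _ (hh _) (hh _))

variable (w) in
/-- transition operator of the relaxed logit dynamics -/
noncomputable def Qop (h : (Fin N → X) → ℝ) (s : Fin N → X) : ℝ :=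
  (1 / (2 * (N : ℝ) ^ 2)) * ∑ p : Fin N × Fin N, h (s ∘ Equiv.swap p.1 p.2) +
    (1 / (2 * (N : ℝ))) * ∑ i, Gi w i h s

theorem sum_offDiag (f : Fin N → Fin N → ℝ) (hf : ∀ i j, f i j = f j i) :
    ∑ p ∈ (Finset.univ : Finset (Fin N)).offDiag, f p.1 p.2 =
      2 * ∑ κ, ∑ i ∈ Finset.Iio κ, f i κ := by
  have h1 : ∑ p ∈ (Finset.univ : Finset (Fin N)).offDiag, f p.1 p.2 =
      ∑ κ, ∑ i, ((if i < κ then f i κ else 0) + (if κ < i then f κ i else 0)) := by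
    have : (Finset.univ : Finset (Fin N)).offDiag = Finset.univ.filter (fun p : Fin N × Fin N => p.1 ≠ p.2) := by
      ext p; simp
    rw [this, Finset.sum_filter, Fintype.sum_prod_type]
    refine Finset.sum_congr rfl fun κ _ => Finset.sum_congr rfl fun i _ => ?_
    rcases lt_trichotomy i κ with h | h | h
    · simp [h, h.ne', not_lt.2 h.le, hf κ i]
    · simp [h]
    · simp [h, h.ne, not_lt.2 h.le]
  have h2 : ∑ κ, ∑ i, (if κ < i then f κ i else 0) = ∑ κ, ∑ i, (if i < κ then f i κ else 0) :=
    Finset.sum_comm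
  have h3 : ∀ κ, ∑ i, (if i < κ then f i κ else 0) = ∑ i ∈ Finset.Iio κ, f i κ := by
    intro κ
    rw [← Finset.sum_filter]
    congr 1
    ext i; simp
  rw [h1]
  simp only [Finset.sum_add_distrib]
  rw [h2]
  simp only [h3]; ring

theorem F_S (hN : 2 ≤ N) (hw : ∀ s, 0 < w s) (hws : ∀ (σ : Equiv.Perm (Fin N)) s, w (s ∘ σ) = w s)
    (h : (Fin N → X) → ℝ) (hh : ∀ s, 0 ≤ h s) :
    F w (fun s => (1 / (N : ℝ) ^ 2) * ∑ p : Fin N × Fin N, h (s ∘ Equiv.swap p.1 p.2)) ≤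
      F w h - 4 / ((N : ℝ) ^ 2 * (N - 1)) * ∑ κ, ∑ i ∈ Finset.Iio κ, pg w (Equiv.swap i κ) h := by
  have hN2 : (2 : ℝ) ≤ N := by exact_mod_cast hN
  have hN0 : (0 : ℝ) < N := by linarith
  have hN1 : (0 : ℝ) < (N : ℝ) - 1 := by linarith
  have hw' : ∀ s, 0 ≤ w s := fun s => (hw s).le
  let I := (Finset.univ : Finset (Fin N)).offDiag
  have hcard : (I.card : ℝ) = N * (N - 1) := by
    have : I.card = N * N - N := by simp [I, Finset.offDiag_card]
    rw [this, Nat.cast_sub (Nat.le_mul_self N)]; push_cast; ring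
  have e : (fun s => (1 / (N : ℝ) ^ 2) * ∑ p : Fin N × Fin N, h (s ∘ Equiv.swap p.1 p.2)) =
      fun s => ∑ p ∈ I, (1 / ((N : ℝ) * (N - 1))) *
        ((2 / (N : ℝ)) * ((h s + h (s ∘ Equiv.swap p.1 p.2)) / 2) + (1 - 2 / (N : ℝ)) * h (s ∘ Equiv.swap p.1 p.2)) := by
    funext s
    have h1 : ∑ p : Fin N × Fin N, h (s ∘ Equiv.swap p.1 p.2) =
        N * h s + ∑ p ∈ I, h (s ∘ Equiv.swap p.1 p.2) := by
      have hu : (Finset.univ : Finset (Fin N × Fin N)) = (Finset.univ : Finset (Fin N)).diag ∪ I := by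
        rw [Finset.diag_union_offDiag]; rfl
      rw [hu, Finset.sum_union (Finset.disjoint_diag_offDiag _)]
      congr 1
      rw [Finset.sum_diag]
      simp
    have h2 : ∀ p ∈ I, (1 / ((N : ℝ) * (N - 1))) *
        ((2 / (N : ℝ)) * ((h s + h (s ∘ Equiv.swap p.1 p.2)) / 2) + (1 - 2 / (N : ℝ)) * h (s ∘ Equiv.swap p.1 p.2))
        = (1 / ((N : ℝ) ^ 2 * (N - 1))) * h s + (1 / (N : ℝ) ^ 2) * h (s ∘ Equiv.swap p.1 p.2) := by
      intro p _
      have := hN1.ne'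
      field_simp; ring
    rw [h1, Finset.sum_congr rfl h2, Finset.sum_add_distrib, ← Finset.mul_sum, ← Finset.mul_sum,
      Finset.sum_const, nsmul_eq_mul, hcard]
    have := hN1.ne'
    field_simp
  rw [e]
  have hn2 : 0 ≤ 1 - 2 / (N : ℝ) := by rw [sub_nonneg, div_le_one hN0]; exact hN2
  refine (F_convex hw' I (fun _ => 1 / ((N : ℝ) * (N - 1))) (fun p s =>
        ((2 / (N : ℝ)) * ((h s + h (s ∘ Equiv.swap p.1 p.2)) / 2) + (1 - 2 / (N : ℝ)) * h (s ∘ Equiv.swap p.1 p.2)))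
      ?_ ?_ ?_).trans ?_
  · intro p _ s
    have := hh s; have := hh (s ∘ Equiv.swap p.1 p.2)
    positivity
  · intro p _; positivity
  · rw [Finset.sum_const, nsmul_eq_mul, hcard]
    have := hN1.ne'
    field_simp
  · have hp : ∀ p ∈ I, (1 / ((N : ℝ) * (N - 1))) * F w (fun s =>
        ((2 / (N : ℝ)) * ((h s + h (s ∘ Equiv.swap p.1 p.2)) / 2) + (1 - 2 / (N : ℝ)) * h (s ∘ Equiv.swap p.1 p.2)))
        ≤ (1 / ((N : ℝ) * (N - 1))) * (F w h - 2 / (N : ℝ) * pg w (Equiv.swap p.1 p.2) h) := by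
      intro p _
      refine mul_le_mul_of_nonneg_left ?_ (by positivity)
      have := F_convex2 hw' (fun s => (h s + h (s ∘ Equiv.swap p.1 p.2)) / 2) (fun s => h (s ∘ Equiv.swap p.1 p.2))
        (2 / (N : ℝ)) (1 - 2 / (N : ℝ)) (fun s => by have := hh s; have := hh (s ∘ Equiv.swap p.1 p.2); positivity)
        (fun s => hh _) (by positivity) hn2 (by ring)
      rw [F_perm hws] at this
      rw [pg_eq hws]
      refine this.trans (le_of_eq ?_)
      ring
    refine (Finset.sum_le_sum hp).trans (le_of_eq ?_)
    rw [← Finset.mul_sum, Finset.sum_sub_distrib, Finset.sum_const, nsmul_eq_mul, hcard, ← Finset.mul_sum]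
    have h4 : ∑ p ∈ I, pg w (Equiv.swap p.1 p.2) h = 2 * ∑ κ, ∑ i ∈ Finset.Iio κ, pg w (Equiv.swap i κ) h :=
      sum_offDiag (fun i j => pg w (Equiv.swap i j) h) (fun i j => by rw [Equiv.swap_comm])
    rw [h4]
    have := hN1.ne'
    field_simp; ring

theorem contract (M : ℕ) (hM : 1 ≤ M) [Nonempty X] (w : (Fin (M + 1) → X) → ℝ) (b : Multiset X → ℝ)
    (hb : ∀ σ, 0 < b σ) (hwb : ∀ s, w s = b ↑(List.ofFn s))
    (hR : ∀ σ : Multiset X, Multiset.card σ + 2 = M + 1 → RCS (fun x y => b (x ::ₘ y ::ₘ σ)))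
    (hw1 : ∑ s, w s = 1) (h : (Fin (M + 1) → X) → ℝ) (hh : ∀ s, 0 ≤ h s) (hh1 : ∑ s, w s * h s = 1) :
    F w (Qop w h) ≤ (1 - 1 / ((M + 1 : ℕ) : ℝ) ^ 3) * F w h := by
  have hw : ∀ s, 0 < w s := fun s => by rw [hwb]; exact hb _
  have hw' : ∀ s, 0 ≤ w s := fun s => (hw s).le
  have hws : ∀ (σ : Equiv.Perm (Fin (M + 1))) s, w (s ∘ σ) = w s := by
    intro σ s
    rw [hwb, hwb]; congr 1
    exact Multiset.coe_eq_coe.2 (σ.ofFn_comp_perm s)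
  obtain ⟨g, hg0, hgI, hg1, hgG, -, hgF⟩ := symmetrize hw hws h hh (M + 1) le_rfl
  have hgs : ∀ (σ : Equiv.Perm (Fin (M + 1))) s, g (s ∘ σ) = g s := fun σ s =>
    hgI σ (fun i hi => absurd i.isLt (not_lt.2 hi)) s
  rw [hh1] at hg1
  have hgF' : F w h - F w g ≤ ∑ κ, ∑ i ∈ Finset.Iio κ, pg w (Equiv.swap i κ) h := by
    refine hgF.trans (le_of_eq ?_)
    congr 1
    ext κ
    have := κ.isLt
    simp; omega
  set P := ∑ κ, ∑ i ∈ Finset.Iio κ, pg w (Equiv.swap i κ) h with hP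
  have hP0 : 0 ≤ P := Finset.sum_nonneg fun κ _ => Finset.sum_nonneg fun i _ => pg_nonneg hw' _ h hh
  have hB0 : 0 ≤ F w g := F_nonneg hw' hw1 g hg0 hg1
  set n : ℝ := ((M + 1 : ℕ) : ℝ) with hn
  have hnM : n = (M : ℝ) + 1 := by rw [hn]; push_cast; rfl
  have hM1 : (1 : ℝ) ≤ M := by exact_mod_cast hM
  have hn0 : 0 < n := by linarith
  -- heat bath part
  have hGam : F w g ≤ ∑ i, Gam w i g := by
    have h1 : ∀ i, Gam w i g = Gam w 0 g := by
      intro i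
      have := Gam_perm hws (Equiv.swap 0 i) i g
      simp only [hgs] at this
      rw [Equiv.symm_swap, Equiv.swap_apply_right] at this
      exact this
    simp only [h1]
    rw [Finset.sum_const, nsmul_eq_mul, Finset.card_univ, Fintype.card_fin, ← hn, Gam_eq hw]
    have := mlsi_sym w g b hb hwb hR hw1 hg0 hg1 hgs
    rw [hnM]; nlinarith
  have hG : F w (fun s => ∑ i, (1 / n) * Gi w i h s) ≤ F w h - (1 / n) * F w g := by
    refine (F_convex hw' Finset.univ (fun _ => 1 / n) (fun i s => Gi w i h s) ?_ ?_ ?_).trans ?_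
    · intro i _ s; exact Gi_nonneg hw i h hh s
    · intro i _; positivity
    · rw [Finset.sum_const, nsmul_eq_mul, Finset.card_univ, Fintype.card_fin, ← hn]
      field_simp
    · have h2 : ∀ i, F w (fun s => Gi w i h s) = F w h - Gam w i h := by
        intro i
        have := Gam_eq hw i h
        change F w (Gi w i h) = _
        linarith
      simp only [h2]
      rw [← Finset.mul_sum, Finset.sum_sub_distrib, Finset.sum_const, nsmul_eq_mul, Finset.card_univ,
        Fintype.card_fin, ← hn]
      have h3 := mul_le_mul_of_nonneg_left (hGam.trans hgG) (show 0 ≤ 1 / n by positivity)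
      have h4 : 1 / n * (n * F w h) = F w h := by field_simp
      rw [mul_sub, h4]; linarith
  have hS := F_S (by omega) hw hws h hh
  rw [← hn, ← hP] at hS
  have hQ : Qop w h = fun s => (1 / 2) * ((1 / n ^ 2) * ∑ p : Fin (M + 1) × Fin (M + 1), h (s ∘ Equiv.swap p.1 p.2)) +
      (1 / 2) * ∑ i, (1 / n) * Gi w i h s := by
    funext s
    unfold Qop
    rw [← Finset.mul_sum, ← hn]
    field_simp
  have hQF := F_convex2 hw' (fun s => (1 / n ^ 2) * ∑ p : Fin (M + 1) × Fin (M + 1), h (s ∘ Equiv.swap p.1 p.2))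
    (fun s => ∑ i, (1 / n) * Gi w i h s) (1 / 2) (1 / 2)
    (fun s => mul_nonneg (by positivity) (Finset.sum_nonneg fun p _ => hh _))
    (fun s => Finset.sum_nonneg fun i _ => mul_nonneg (by positivity) (Gi_nonneg hw i h hh s))
    (by norm_num) (by norm_num) (by norm_num)
  rw [hQ]
  refine hQF.trans ?_
  have c1 : 1 / n ^ 3 * F w g ≤ 1 / (2 * n) * F w g := by
    refine mul_le_mul_of_nonneg_right ?_ hB0
    refine one_div_le_one_div_of_le (by positivity) ?_
    nlinarith [sq_nonneg n]
  have c2 : 1 / n ^ 3 * P ≤ 2 / (n ^ 2 * (n - 1)) * P := by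
    refine mul_le_mul_of_nonneg_right ?_ hP0
    have hn1 : 0 < n - 1 := by linarith
    rw [div_le_div_iff₀ (by positivity) (by positivity)]
    nlinarith [sq_nonneg n, pow_pos hn0 3]
  have c3 : 4 / (n ^ 2 * (n - 1)) * P = 2 * (2 / (n ^ 2 * (n - 1)) * P) := by ring
  have c4 : 1 / n * F w g = 2 * (1 / (2 * n) * F w g) := by field_simp
  have c5 : 1 / n ^ 3 * F w h ≤ 1 / n ^ 3 * (F w g + P) :=
    mul_le_mul_of_nonneg_left (by linarith) (by positivity)
  rw [c3] at hS
  rw [c4] at hG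
  nlinarith
end G1
end RL

namespace RL
section H1
variable {N : ℕ} {X : Type*} [Fintype X] {w : (Fin N → X) → ℝ}

theorem Qop_nonneg (hw : ∀ s, 0 < w s) (h : (Fin N → X) → ℝ) (hh : ∀ s, 0 ≤ h s) (s : Fin N → X) :
    0 ≤ Qop w h s := by
  unfold Qop
  have h1 : 0 ≤ ∑ p : Fin N × Fin N, h (s ∘ Equiv.swap p.1 p.2) := Finset.sum_nonneg fun p _ => hh _
  have h2 : 0 ≤ ∑ i, Gi w i h s := Finset.sum_nonneg fun i _ => Gi_nonneg hw i h hh s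
  positivity

theorem Qop_sum (hN : 1 ≤ N) (hw : ∀ s, 0 < w s) (hws : ∀ (σ : Equiv.Perm (Fin N)) s, w (s ∘ σ) = w s)
    (h : (Fin N → X) → ℝ) : ∑ s, w s * Qop w h s = ∑ s, w s * h s := by
  have hN0 : (N : ℝ) ≠ 0 := by have : N ≠ 0 := by omega
                               exact_mod_cast this
  have h1 : ∀ i, ∑ s, w s * Gi w i h s = ∑ s, w s * h s := by
    intro i
    have := sum_Gi_mul hw i h (fun _ => 1) (fun _ _ => rfl)
    simpa using this
  have h2 : ∀ p : Fin N × Fin N, ∑ s, w s * h (s ∘ Equiv.swap p.1 p.2) = ∑ s, w s * h s := by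
    intro p
    rw [← sum_comp_perm (Equiv.swap p.1 p.2) (fun s => w s * h s)]
    exact Finset.sum_congr rfl fun s _ => by rw [hws]
  have e : ∀ s, w s * Qop w h s = (1 / (2 * (N : ℝ) ^ 2)) * ∑ p : Fin N × Fin N, w s * h (s ∘ Equiv.swap p.1 p.2)
      + (1 / (2 * (N : ℝ))) * ∑ i, w s * Gi w i h s := by
    intro s; unfold Qop; rw [← Finset.mul_sum, ← Finset.mul_sum]; ring
  simp only [e]
  rw [Finset.sum_add_distrib, ← Finset.mul_sum, ← Finset.mul_sum, Finset.sum_comm,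
    Finset.sum_comm (f := fun s i => w s * Gi w i h s)]
  simp only [h1, h2]
  simp
  field_simp
  ring

theorem pow_zero_apply' [DecidableEq X] (K : Matrix (Fin N → X) (Fin N → X) ℝ) (s y : Fin N → X) :
    (K ^ 0) s y = if s = y then 1 else 0 := by
  rw [pow_zero, Matrix.one_apply]

/-- iterated density -/
theorem density_step (K : Matrix (Fin N → X) (Fin N → X) ℝ) [DecidableEq X] (hw : ∀ s, 0 < w s)
    (hrev : ∀ x y, w x * K x y = w y * K y x) (hK : ∀ h s, ∑ y, K s y * h y = Qop w h s)
    (s : Fin N → X) (t : ℕ) :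
    (fun y => (K ^ (t + 1)) s y / w y) = Qop w (fun y => (K ^ t) s y / w y) := by
  funext y
  rw [← hK, pow_succ, Matrix.mul_apply, Finset.sum_div]
  refine Finset.sum_congr rfl fun x _ => ?_
  have h1 := (hw x).ne'
  have h2 := (hw y).ne'
  field_simp
  have := hrev x y
  linear_combination ((K ^ t) s x) * this

theorem density_props (hN : 1 ≤ N) (K : Matrix (Fin N → X) (Fin N → X) ℝ) [DecidableEq X] (hw : ∀ s, 0 < w s)
    (hws : ∀ (σ : Equiv.Perm (Fin N)) s, w (s ∘ σ) = w s)
    (hrev : ∀ x y, w x * K x y = w y * K y x) (hK : ∀ h s, ∑ y, K s y * h y = Qop w h s)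
    (s : Fin N → X) (t : ℕ) :
    (∀ y, 0 ≤ (K ^ t) s y / w y) ∧ ∑ y, w y * ((K ^ t) s y / w y) = 1 := by
  induction t with
  | zero =>
    constructor
    · intro y
      rw [pow_zero_apply']
      have := hw y
      split_ifs <;> positivity
    · have : ∀ y, w y * ((K ^ 0) s y / w y) = if s = y then 1 else 0 := by
        intro y
        rw [pow_zero_apply']
        have := (hw y).ne'
        split_ifs <;> field_simp
      simp only [this]
      rw [Finset.sum_ite_eq]; simp
  | succ t ih =>
    have e := density_step K hw hrev hK s t
    constructor
    · intro y
      rw [congrFun e y]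
      exact Qop_nonneg hw _ ih.1 y
    · have : ∀ y, w y * ((K ^ (t + 1)) s y / w y) = w y * Qop w (fun y => (K ^ t) s y / w y) y := by
        intro y; rw [← congrFun e y]
      simp only [this]
      rw [Qop_sum hN hw hws]
      exact ih.2

theorem F_zero [DecidableEq X] (hw : ∀ s, 0 < w s) (K : Matrix (Fin N → X) (Fin N → X) ℝ) (s : Fin N → X) :
    F w (fun y => (K ^ 0) s y / w y) = - Real.log (w s) := by
  unfold F
  rw [Finset.sum_eq_single s]
  · beta_reduce
    rw [pow_zero_apply', if_pos rfl]
    unfold phi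
    have := (hw s).ne'
    rw [one_div, Real.log_inv]; field_simp
  · intro y _ hy
    beta_reduce
    rw [pow_zero_apply', if_neg hy.symm]; simp [phi]
  · simp

theorem tv_eq [DecidableEq X] (hw : ∀ s, 0 < w s) (k : (Fin N → X) → ℝ) :
    ∑ y, |k y - w y| = ∑ y, w y * |k y / w y - 1| := by
  refine Finset.sum_congr rfl fun y _ => ?_
  have h := hw y
  rw [← abs_of_pos h, ← abs_mul, abs_of_pos h]
  congr 1
  field_simp

theorem update_sum [DecidableEq X] (s : Fin N → X) (i : Fin N) (f : (Fin N → X) → ℝ) :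
    ∑ y ∈ Finset.univ.filter (fun y : Fin N → X => ∀ j, j ≠ i → y j = s j), f y =
      ∑ r, f (Function.update s i r) := by
  symm
  refine Finset.sum_bij (fun r _ => Function.update s i r) ?_ ?_ ?_ ?_
  · intro r _
    simp only [Finset.mem_filter, Finset.mem_univ, true_and]
    intro j hj; exact Function.update_of_ne hj _ _
  · intro r _ r' _ h
    exact Function.update_injective s i h
  · intro y hy
    simp only [Finset.mem_filter, Finset.mem_univ, true_and] at hy
    refine ⟨y i, Finset.mem_univ _, ?_⟩
    funext j
    by_cases hj : j = i
    · subst hj; simp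
    · rw [Function.update_of_ne hj, hy j hj]
  · intro r _; rfl

/-- one player -/
theorem one_player [DecidableEq X] (w : (Fin 1 → X) → ℝ) (hw : ∀ s, 0 < w s) (hw1 : ∑ s, w s = 1)
    (K : Matrix (Fin 1 → X) (Fin 1 → X) ℝ)
    (hrev : ∀ x y, w x * K x y = w y * K y x) (hK : ∀ h s, ∑ y, K s y * h y = Qop w h s)
    (s : Fin 1 → X) (t : ℕ) :
    ∑ y, w y * |(K ^ t) s y / w y - 1| ≤ 2 * (1 / 2) ^ t := by
  have hws : ∀ (σ : Equiv.Perm (Fin 1)) s, w (s ∘ σ) = w s := by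
    intro σ s
    have : σ = 1 := Subsingleton.elim _ _
    subst this; rfl
  have hp := density_props le_rfl K hw hws hrev hK s
  induction t with
  | zero =>
    have h0 := hp 0
    have : ∑ y, w y * |(K ^ 0) s y / w y - 1| ≤ ∑ y, (w y * ((K ^ 0) s y / w y) + w y) := by
      refine Finset.sum_le_sum fun y _ => ?_
      have h1 := h0.1 y
      have : |(K ^ 0) s y / w y - 1| ≤ (K ^ 0) s y / w y + 1 := by
        rw [abs_le]; constructor <;> linarith
      nlinarith [hw y]
    rw [Finset.sum_add_distrib, h0.2, hw1] at this
    rw [pow_zero (1 / 2 : ℝ)]; linarith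
  | succ t ih =>
    have e := density_step K hw hrev hK s t
    have hG : ∀ h : (Fin 1 → X) → ℝ, ∀ s, ∑ r, h (Function.update s 0 r) = ∑ s, h s := by
      intro h s
      rw [sum_cons]
      refine Finset.sum_congr rfl fun r _ => ?_
      rw [Fintype.sum_unique]
      congr 1
      funext j
      have : j = 0 := Subsingleton.elim _ _
      subst this; simp
    have hQ : ∀ y, (K ^ (t + 1)) s y / w y - 1 = (1 / 2) * ((K ^ t) s y / w y - 1) := by
      intro y
      rw [congrFun e y]
      unfold Qop Gi
      have hsw : ∀ p : Fin 1 × Fin 1, y ∘ Equiv.swap p.1 p.2 = y := by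
        intro p
        have : Equiv.swap p.1 p.2 = 1 := Subsingleton.elim _ _
        rw [this]; rfl
      simp only [hsw]
      rw [Finset.sum_const, Fin.sum_univ_one,
        hG (fun y => w y * ((K ^ t) s y / w y)) y, hG w y, (hp t).2, hw1]
      simp
      ring
    have : ∀ y, w y * |(K ^ (t + 1)) s y / w y - 1| = (1 / 2) * (w y * |(K ^ t) s y / w y - 1|) := by
      intro y; rw [hQ, abs_mul, abs_of_pos (by norm_num : (0:ℝ) < 1 / 2)]; ring
    simp only [this]
    rw [← Finset.mul_sum, pow_succ]
    linarith

theorem many_players [DecidableEq X] (M : ℕ) (hM : 1 ≤ M) [Nonempty X] (w : (Fin (M + 1) → X) → ℝ)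
    (b : Multiset X → ℝ)
    (hb : ∀ σ, 0 < b σ) (hwb : ∀ s, w s = b ↑(List.ofFn s))
    (hR : ∀ σ : Multiset X, Multiset.card σ + 2 = M + 1 → RCS (fun x y => b (x ::ₘ y ::ₘ σ)))
    (hw1 : ∑ s, w s = 1)
    (K : Matrix (Fin (M + 1) → X) (Fin (M + 1) → X) ℝ)
    (hrev : ∀ x y, w x * K x y = w y * K y x) (hK : ∀ h s, ∑ y, K s y * h y = Qop w h s)
    (s : Fin (M + 1) → X) (t : ℕ) :
    (∑ y, w y * |(K ^ t) s y / w y - 1|) ^ 2 ≤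
      4 * (Real.exp (- (t / ((M + 1 : ℕ) : ℝ) ^ 3)) * (- Real.log (w s))) := by
  have hw : ∀ s, 0 < w s := fun s => by rw [hwb]; exact hb _
  have hw' : ∀ s, 0 ≤ w s := fun s => (hw s).le
  have hws : ∀ (σ : Equiv.Perm (Fin (M + 1))) s, w (s ∘ σ) = w s := by
    intro σ s
    rw [hwb, hwb]; congr 1
    exact Multiset.coe_eq_coe.2 (σ.ofFn_comp_perm s)
  have hp := density_props (by omega) K hw hws hrev hK s
  refine (pinsker hw' hw1 _ (hp t).1 (hp t).2).trans ?_
  refine mul_le_mul_of_nonneg_left ?_ (by norm_num)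
  induction t with
  | zero => rw [F_zero hw]; simp
  | succ t ih =>
    rw [density_step K hw hrev hK s t]
    refine (contract M hM w b hb hwb hR hw1 _ (hp t).1 (hp t).2).trans ?_
    have h0 := F_nonneg hw' hw1 _ (hp t).1 (hp t).2
    set n : ℝ := ((M + 1 : ℕ) : ℝ)
    have h1 : 1 - 1 / n ^ 3 ≤ Real.exp (- (1 / n ^ 3)) := by
      have := Real.add_one_le_exp (- (1 / n ^ 3)); linarith
    calc _ ≤ Real.exp (- (1 / n ^ 3)) * F w (fun y => (K ^ t) s y / w y) := mul_le_mul_of_nonneg_right h1 h0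
      _ ≤ Real.exp (- (1 / n ^ 3)) * (Real.exp (-(t / n ^ 3)) * -Real.log (w s)) :=
        mul_le_mul_of_nonneg_left ih (Real.exp_pos _).le
      _ = _ := by
        rw [← mul_assoc, ← Real.exp_add]
        congr 2
        push_cast; ring
end H1
end RL

namespace RL

theorem sPhi_nonneg (c : E → ℕ → ℝ) (hc0 : ∀ e k, 0 ≤ c e k) (s : SymProfile n P) : 0 ≤ sPhi c s :=
  Finset.sum_nonneg fun _ _ => Finset.sum_nonneg fun _ _ => hc0 _ _

theorem sZ_pos [Nonempty {A : Finset E // A ∈ P}] (c : E → ℕ → ℝ) (T : ℝ) : 0 < sZ c T n P :=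
  Finset.sum_pos (fun _ _ => Real.exp_pos _) Finset.univ_nonempty

theorem sGibbs_pos [Nonempty {A : Finset E // A ∈ P}] (c : E → ℕ → ℝ) (T : ℝ) (s : SymProfile n P) :
    0 < sGibbs c T s := div_pos (Real.exp_pos _) (sZ_pos c T)

theorem sGibbs_sum [Nonempty {A : Finset E // A ∈ P}] (c : E → ℕ → ℝ) (T : ℝ) :
    ∑ s : SymProfile n P, sGibbs c T s = 1 := by
  unfold sGibbs
  rw [← Finset.sum_div]
  exact div_self (sZ_pos c T).ne'

theorem sPhi_perm (c : E → ℕ → ℝ) (σ : Equiv.Perm (Fin n)) (s : SymProfile n P) :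
    sPhi c (s ∘ σ) = sPhi c s := by
  have h : ∀ e, sload (s ∘ σ) e = sload s e := by
    intro e
    unfold sload
    refine Finset.card_bij (fun i _ => σ i) ?_ ?_ ?_
    · intro i hi; simpa using hi
    · intro i _ j _ hij; exact σ.injective hij
    · intro i hi
      exact ⟨σ.symm i, by simpa using hi, by simp⟩
  unfold sPhi
  simp only [h]

theorem matrix_op [Nonempty {A : Finset E // A ∈ P}] (c : E → ℕ → ℝ) (T : ℝ)
    (h : SymProfile n P → ℝ) (s : SymProfile n P) :
    ∑ y, relaxedLogitMatrix c T n P s y * h y = Qop (fun y : SymProfile n P => sGibbs c T y) h s := by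
  unfold relaxedLogitMatrix Qop
  simp only [Matrix.of_apply, add_mul]
  rw [Finset.sum_add_distrib]
  congr 1
  · simp only [mul_assoc]
    rw [← Finset.mul_sum]
    congr 1
    have h1 : ∀ y : SymProfile n P, (((Finset.univ.filter fun ij : Fin n × Fin n => s ∘ Equiv.swap ij.1 ij.2 = y).card : ℝ)) * h y
        = ∑ p : Fin n × Fin n, if s ∘ Equiv.swap p.1 p.2 = y then h y else 0 := by
      intro y
      rw [← Finset.sum_filter, Finset.sum_const, nsmul_eq_mul]
    rw [Finset.sum_congr rfl fun y _ => h1 y, Finset.sum_comm]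
    refine Finset.sum_congr rfl fun p _ => ?_
    rw [Finset.sum_ite_eq]; simp
  · simp only [mul_assoc]
    rw [← Finset.mul_sum]
    congr 1
    have h1 : ∀ y : SymProfile n P, (∑ i ∈ Finset.univ.filter fun i : Fin n => ∀ j, j ≠ i → y j = s j,
          Real.exp (-T * sPhi c y) / sZi c T s i) * h y
        = ∑ i, if (∀ j, j ≠ i → y j = s j) then Real.exp (-T * sPhi c y) / sZi c T s i * h y else 0 := by
      intro y
      rw [← Finset.sum_filter, Finset.sum_mul]
    rw [Finset.sum_congr rfl fun y _ => h1 y, Finset.sum_comm]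
    refine Finset.sum_congr rfl fun i _ => ?_
    rw [← Finset.sum_filter, update_sum]
    unfold Gi sGibbs
    rw [← Finset.sum_div]
    have hZ := (sZ_pos (n := n) (P := P) c T).ne'
    change _ = _ / (sZi c T s i / sZ c T n P)
    have hZi : sZi c T s i ≠ 0 :=
      (Finset.sum_pos (fun _ _ => Real.exp_pos _) Finset.univ_nonempty).ne'
    rw [Finset.sum_div]
    refine Finset.sum_congr rfl fun r _ => ?_
    field_simp

theorem matrix_rev (c : E → ℕ → ℝ) (T : ℝ) (x y : SymProfile n P) :
    sGibbs c T x * relaxedLogitMatrix c T n P x y = sGibbs c T y * relaxedLogitMatrix c T n P y x := by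
  unfold relaxedLogitMatrix
  simp only [Matrix.of_apply, mul_add]
  congr 1
  · have hiff : ∀ ij : Fin n × Fin n, x ∘ Equiv.swap ij.1 ij.2 = y ↔ y ∘ Equiv.swap ij.1 ij.2 = x := by
      intro ij
      constructor
      · rintro rfl; funext k; simp
      · rintro rfl; funext k; simp
    have hf : (Finset.univ.filter fun ij : Fin n × Fin n => x ∘ Equiv.swap ij.1 ij.2 = y) =
        Finset.univ.filter fun ij : Fin n × Fin n => y ∘ Equiv.swap ij.1 ij.2 = x :=
      Finset.filter_congr fun ij _ => hiff ij
    rw [← hf]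
    by_cases hne : (Finset.univ.filter fun ij : Fin n × Fin n => x ∘ Equiv.swap ij.1 ij.2 = y).Nonempty
    · obtain ⟨ij, hij⟩ := hne
      have h2 := (Finset.mem_filter.1 hij).2
      have : sGibbs c T x = sGibbs c T y := by
        unfold sGibbs
        rw [← h2, sPhi_perm]
      rw [this]
    · rw [Finset.not_nonempty_iff_eq_empty] at hne
      rw [hne]; simp
  · have hf : (Finset.univ.filter fun i : Fin n => ∀ j, j ≠ i → y j = x j) =
        Finset.univ.filter fun i : Fin n => ∀ j, j ≠ i → x j = y j :=
      Finset.filter_congr fun i _ => ⟨fun h j hj => (h j hj).symm, fun h j hj => (h j hj).symm⟩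
    rw [hf, Finset.mul_sum, Finset.mul_sum, Finset.mul_sum, Finset.mul_sum]
    refine Finset.sum_congr rfl fun i hi => ?_
    have hi' := (Finset.mem_filter.1 hi).2
    have hz : sZi c T x i = sZi c T y i := by
      unfold sZi
      refine Finset.sum_congr rfl fun r _ => ?_
      have : Function.update x i r = Function.update y i r := by
        funext j
        by_cases hj : j = i
        · subst hj; simp
        · rw [Function.update_of_ne hj, Function.update_of_ne hj, hi' j hj]
      rw [this]
    rw [hz]
    unfold sGibbs
    ring

theorem base_RCS [Nonempty {A : Finset E // A ∈ P}] (T : ℝ) (hT : 0 ≤ T)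
    (PhiL : ({A : Finset E // A ∈ P} → ℕ) → ℝ)
    (hM : ∀ αv βv : {A : Finset E // A ∈ P} → ℕ,
      (∑ p, αv p) = n → (∑ p, βv p) = n →
      ∀ p, βv p < αv p → ∃ p', αv p' < βv p' ∧
        PhiL (loadMove αv p p') + PhiL (loadMove βv p' p) ≤ PhiL αv + PhiL βv)
    (Z : ℝ) (hZ : 0 < Z) (σ : Multiset {A : Finset E // A ∈ P}) (hσ : Multiset.card σ + 2 = n) :
    RCS (fun x y => Real.exp (-T * PhiL (fun p => Multiset.count p (x ::ₘ y ::ₘ σ))) / Z) := by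
  set q : {A : Finset E // A ∈ P} → {A : Finset E // A ∈ P} → ℝ :=
    fun x y => PhiL (fun p => Multiset.count p (x ::ₘ y ::ₘ σ)) with hq
  have hqs : ∀ x y, q x y = q y x := by
    intro x y; simp only [hq, Multiset.cons_swap x y]
  change RCS (fun x y => Real.exp (-T * q x y) / Z)
  apply RCS_of_four_point
  · intro x y; positivity
  · intro x y; rw [hqs]
  · intro x y z t
    have key : q x z + q y t ≤ q x y + q z t ∨ q x t + q y z ≤ q x y + q z t := by
      by_cases hxz : x = z
      · right; subst hxz; rw [hqs y x]; linarith
      by_cases hxt : x = t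
      · left; subst hxt; rw [hqs y x, hqs z x]; linarith
      have hsum : ∀ u v, ∑ p, Multiset.count p (u ::ₘ v ::ₘ σ) = n := by
        intro u v
        rw [Multiset.sum_count_eq_card (fun a _ => Finset.mem_univ a)]
        simp only [Multiset.card_cons]; omega
      obtain ⟨p', hp, hle⟩ := hM (fun p => Multiset.count p (x ::ₘ y ::ₘ σ))
        (fun p => Multiset.count p (z ::ₘ t ::ₘ σ)) (hsum x y) (hsum z t) x (by
          simp only [Multiset.count_cons, if_neg hxz, if_neg hxt, if_true]
          omega)
      have hp' : p' = z ∨ p' = t := by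
        by_contra hcon
        push Not at hcon
        simp only [Multiset.count_cons, if_neg hcon.1, if_neg hcon.2] at hp
        omega
      have mv1 : ∀ u, x ≠ u → loadMove (fun p => Multiset.count p (x ::ₘ y ::ₘ σ)) x u =
          fun p => Multiset.count p (y ::ₘ u ::ₘ σ) := by
        intro u hu
        funext l
        simp only [loadMove, Multiset.count_cons]
        split_ifs <;> omega
      have mv2 : ∀ u v, loadMove (fun p => Multiset.count p (u ::ₘ v ::ₘ σ)) u x =
          fun p => Multiset.count p (x ::ₘ v ::ₘ σ) := by
        intro u v
        funext l
        simp only [loadMove, Multiset.count_cons]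
        split_ifs <;> omega
      rcases hp' with rfl | rfl
      · right
        rw [mv1 p' hxz, mv2 p' t] at hle
        simp only [hq]; linarith
      · left
        rw [mv1 p' hxt, Multiset.cons_swap z p' σ, mv2 p' z] at hle
        have e := hqs z p'
        simp only [hq] at e ⊢
        linarith
    have he : ∀ a b : ℝ, Real.exp (-T * a) / Z * (Real.exp (-T * b) / Z) = Real.exp (-T * (a + b)) / Z ^ 2 := by
      intro a b
      rw [mul_add, Real.exp_add]; field_simp
    simp only [he]
    rw [le_max_iff]
    have hmono : ∀ a b : ℝ, a ≤ b → Real.exp (-T * b) / Z ^ 2 ≤ Real.exp (-T * a) / Z ^ 2 := by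
      intro a b hab
      refine div_le_div_of_nonneg_right (Real.exp_le_exp.2 ?_) (by positivity)
      nlinarith
    rcases key with h | h
    · left; exact hmono _ _ h
    · right; exact hmono _ _ h

theorem neg_log_gibbs [Nonempty {A : Finset E // A ∈ P}] (c : E → ℕ → ℝ) (hc0 : ∀ e k, 0 ≤ c e k)
    (T : ℝ) (hT : 0 ≤ T) (s : SymProfile n P) :
    - Real.log (sGibbs c T s) ≤ n * Real.log P.card + T * sPhi c s := by
  unfold sGibbs
  have hZ := sZ_pos (n := n) (P := P) c T
  rw [Real.log_div (Real.exp_pos _).ne' hZ.ne', Real.log_exp]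
  have h1 : sZ c T n P ≤ (P.card : ℝ) ^ n := by
    unfold sZ
    have : ∑ t : SymProfile n P, Real.exp (-T * sPhi c t) ≤ ∑ t : SymProfile n P, (1 : ℝ) := by
      refine Finset.sum_le_sum fun t _ => ?_
      rw [Real.exp_le_one_iff]
      have := mul_nonneg hT (sPhi_nonneg c hc0 t)
      linarith
    refine this.trans (le_of_eq ?_)
    simp
  have h2 := Real.log_le_log hZ h1
  rw [Real.log_pow] at h2
  linarith

end RL

/-- for a symmetric congestion game with `n ≥ 1` players, `q = |P| ≥ 3`
common strategies, non-negative non-decreasing costs, temperature `T ≥ 0`, whose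
Rosenthal potential is M-convex as a function of strategy load profiles, with
`Φ_max = max_s Φ(s)`, `T·Φ_max ≥ 1` and `0 < ε < 1`: for every initial profile `s` and
every integer `t ≥ n³·(log n + log log q + log(2·T·Φ_max/ε²))`, the distribution of the
relaxed logit dynamics after `t` steps is within total variation distance `ε` of the
Gibbs distribution. -/
theorem relaxedLogit_mixing_time
    (hn : 1 ≤ n) (c : E → ℕ → ℝ)
    (hc0 : ∀ e k, 0 ≤ c e k) (hcmono : ∀ e, ∀ k, 1 ≤ k → c e k ≤ c e (k + 1))
    (hq : 3 ≤ P.card)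
    (T : ℝ) (hT : 0 ≤ T)
    (PhiL : ({A : Finset E // A ∈ P} → ℕ) → ℝ)
    (hPhiL : ∀ γ : {A : Finset E // A ∈ P} → ℕ, ∀ s : SymProfile n P,
      (∀ p, zload s p = γ p) → sPhi c s = PhiL γ)
    (hM : ∀ αv βv : {A : Finset E // A ∈ P} → ℕ,
      (∑ p, αv p) = n → (∑ p, βv p) = n →
      ∀ p, βv p < αv p → ∃ p', αv p' < βv p' ∧
        PhiL (loadMove αv p p') + PhiL (loadMove βv p' p) ≤ PhiL αv + PhiL βv)
    (Φmax : ℝ) (hmax : IsGreatest (Set.range fun s : SymProfile n P => sPhi c s) Φmax)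
    (hTmax : 1 ≤ T * Φmax)
    (ε : ℝ) (hε0 : 0 < ε) (hε1 : ε < 1) :
    ∀ s : SymProfile n P, ∀ t : ℕ,
      (n : ℝ) ^ 3 * (Real.log n + Real.log (Real.log (P.card))
          + Real.log (2 * T * Φmax / ε ^ 2)) ≤ (t : ℝ) →
      (1 / 2) * ∑ y : SymProfile n P,
          |((relaxedLogitMatrix c T n P) ^ t) s y - sGibbs c T y| ≤ ε := by
  intro s t ht
  have hne : Nonempty {A : Finset E // A ∈ P} := by
    obtain ⟨A, hA⟩ := Finset.card_pos.1 (show 0 < P.card by omega)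
    exact ⟨⟨A, hA⟩⟩
  have hw : ∀ y : SymProfile n P, 0 < sGibbs c T y := RL.sGibbs_pos c T
  have hw1 : ∑ y : SymProfile n P, sGibbs c T y = 1 := RL.sGibbs_sum c T
  have hrev := RL.matrix_rev (n := n) (P := P) c T
  have hK := RL.matrix_op (n := n) (P := P) c T
  have hlogq : 1 ≤ Real.log P.card := by
    have h3 : (3 : ℝ) ≤ P.card := by exact_mod_cast hq
    rw [Real.le_log_iff_exp_le (by linarith)]
    exact Real.exp_one_lt_three.le.trans h3
  rw [RL.tv_eq hw]
  have hx0 : 0 < T * Φmax := by linarith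
  have hε2 : 0 < ε ^ 2 := by positivity
  obtain ⟨M, rfl⟩ : ∃ M, n = M + 1 := ⟨n - 1, by omega⟩
  rcases Nat.eq_zero_or_pos M with hM0 | hM1
  · subst hM0
    have h1 := RL.one_player (fun y => sGibbs c T y) hw hw1 _ hrev hK s t
    have h2 : (1 / 2 : ℝ) ^ t ≤ ε := by
      have e1 : Real.log (2 * T * Φmax / ε ^ 2) = Real.log 2 + Real.log (T * Φmax) - 2 * Real.log ε := by
        rw [mul_assoc, Real.log_div (by positivity) hε2.ne', Real.log_mul (by norm_num) hx0.ne', Real.log_pow]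
        push_cast; ring
      have e2 := Real.log_nonneg hTmax
      have e3 := Real.log_nonneg hlogq
      have e4 := Real.log_two_gt_d9
      have e5 := Real.log_neg hε0 hε1
      rw [e1] at ht
      norm_num at ht
      have e6 : - 2 * Real.log ε ≤ t := by linarith
      rw [← Real.log_le_log_iff (by positivity) hε0, Real.log_pow, one_div, Real.log_inv]
      nlinarith
    linarith
  · have hb : ∀ σ : Multiset {A : Finset E // A ∈ P},
        0 < Real.exp (-T * PhiL (fun p => Multiset.count p σ)) / sZ c T (M + 1) P := fun σ =>
      div_pos (Real.exp_pos _) (RL.sZ_pos c T)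
    have h1 := RL.many_players M hM1 (fun y => sGibbs c T y)
      (fun σ => Real.exp (-T * PhiL (fun p => Multiset.count p σ)) / sZ c T (M + 1) P) hb
      (fun y => by
        unfold sGibbs
        rw [hPhiL _ y (fun p => (RL.count_ofFn' y p).symm)])
      (fun σ hσ => RL.base_RCS T hT PhiL hM _ (RL.sZ_pos c T) σ hσ) hw1 _ hrev hK s t
    set S := ∑ y : SymProfile (M + 1) P, sGibbs c T y *
      |((relaxedLogitMatrix c T (M + 1) P) ^ t) s y / sGibbs c T y - 1| with hS
    have h2 := RL.neg_log_gibbs c hc0 T hT s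
    have h3 : sPhi c s ≤ Φmax := hmax.2 ⟨s, rfl⟩
    set m : ℝ := ((M + 1 : ℕ) : ℝ) with hm
    have hm1 : 1 ≤ m := by rw [hm]; exact_mod_cast hn
    have hm0 : 0 < m := by linarith
    have hl0 : 0 < Real.log P.card := by linarith
    have ha : 1 ≤ m * Real.log P.card := by nlinarith
    have h4 : - Real.log (sGibbs c T s) ≤ 2 * (m * Real.log P.card) * (T * Φmax) := by
      have := mul_le_mul_of_nonneg_left h3 hT
      nlinarith
    have h5 : Real.log m + Real.log (Real.log P.card) + Real.log (2 * T * Φmax / ε ^ 2) =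
        Real.log (2 * (m * Real.log P.card) * (T * Φmax) / ε ^ 2) := by
      have p1 : 0 < 2 * T * Φmax / ε ^ 2 := by
        rw [mul_assoc]; positivity
      rw [← Real.log_mul hm0.ne' hl0.ne', ← Real.log_mul (by positivity) p1.ne']
      congr 1; ring
    rw [h5] at ht
    set B := 2 * (m * Real.log P.card) * (T * Φmax) with hB
    have hB0 : 0 < B := by positivity
    have h6 : Real.exp (-(t / m ^ 3)) ≤ ε ^ 2 / B := by
      have : Real.log (B / ε ^ 2) ≤ t / m ^ 3 := by
        rw [le_div_iff₀ (by positivity)]; linarith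
      calc Real.exp (-(t / m ^ 3)) ≤ Real.exp (- Real.log (B / ε ^ 2)) := Real.exp_le_exp.2 (by linarith)
        _ = ε ^ 2 / B := by
          rw [← Real.log_inv, Real.exp_log (by positivity), inv_div]
    have h7 : Real.exp (-(t / m ^ 3)) * (- Real.log (sGibbs c T s)) ≤ ε ^ 2 := by
      calc _ ≤ Real.exp (-(t / m ^ 3)) * B := mul_le_mul_of_nonneg_left h4 (Real.exp_pos _).le
        _ ≤ ε ^ 2 / B * B := mul_le_mul_of_nonneg_right h6 hB0.le
        _ = ε ^ 2 := by field_simp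
    have h8 : S ^ 2 ≤ (2 * ε) ^ 2 := by
      have h1' : S ^ 2 ≤ 4 * (Real.exp (-(t / m ^ 3)) * (- Real.log (sGibbs c T s))) := h1
      nlinarith
    have h9 := abs_le_of_sq_le_sq' h8 (by positivity)
    linarith [h9.2]

end
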